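/- arXiv:0708.3839 — 2 statements merged into one kernel-verified Lean document; each statement's English description precedes it below -/
import Mathlib

section
/- If A = kQ/⟨P⟩ is a gentle algebra with Q a connected quiver with two cycles, then #φ_A ∈ {1, 3}, i.e., the total multiplicity of the invariant φ_A is either 1 or 3. -/
open Function CategoryTheory

/-- A finite quiver: finitely many vertices and arrows with source and target maps. -/
structure FinQuiver where
  nV : ℕ
  nA : ℕ
  src : Fin nA → Fin nV
  tgt : Fin nA → Fin nV

namespace FinQuiver

variable (Q : FinQuiver)

/-- Adjacency in the underlying undirected multigraph, using only arrows from `S`. -/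
def adjOn (S : Finset (Fin Q.nA)) (v w : Fin Q.nV) : Prop :=
  ∃ a ∈ S, (Q.src a = v ∧ Q.tgt a = w) ∨ (Q.src a = w ∧ Q.tgt a = v)

/-- Adjacency in the underlying undirected multigraph. -/
def adj (v w : Fin Q.nV) : Prop := Q.adjOn Finset.univ v w

/-- The subquiver with arrows `S` is connected (as an undirected multigraph). -/
def ConnectedOn (S : Finset (Fin Q.nA)) : Prop :=
  ∀ v w : Fin Q.nV, Relation.ReflTransGen (Q.adjOn S) v w

/-- The quiver is connected. -/
def Connected : Prop := 0 < Q.nV ∧ Q.ConnectedOn Finset.univ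

/-- The subquiver on the arrow set `S` is a (spanning) tree: it is connected and
has `#vertices - 1` arrows. -/
def IsSpanningTreeOn (S : Finset (Fin Q.nA)) : Prop :=
  Q.ConnectedOn S ∧ S.card + 1 = Q.nV

/-- The number of cycles of `Q`: the least number of arrows one has to remove from `Q`
in order to obtain a tree. -/
noncomputable def numCycles : ℕ :=
  sInf {n | ∃ R : Finset (Fin Q.nA), R.card = n ∧ Q.IsSpanningTreeOn Rᶜ}

/-- The degree of a vertex: number of arrows starting at `v` plus number of arrows ending
at `v`. -/
def deg (v : Fin Q.nV) : ℕ :=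
  (Finset.univ.filter fun a => Q.src a = v).card +
    (Finset.univ.filter fun a => Q.tgt a = v).card

/-- The two endpoints of a step of an undirected walk: an arrow together with the direction
in which it is traversed. -/
def stepEnds (p : Fin Q.nA × Bool) : Fin Q.nV × Fin Q.nV :=
  if p.2 then (Q.src p.1, Q.tgt p.1) else (Q.tgt p.1, Q.src p.1)

/-- An (undirected) trail: consecutive steps match and no arrow is used twice. -/
def IsTrail (w : List (Fin Q.nA × Bool)) : Prop :=
  (w.map Prod.fst).Nodup ∧ w.Chain' (fun p q => (Q.stepEnds p).2 = (Q.stepEnds q).1)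

/-- A trail from `v` to `v'`. -/
def TrailFromTo (w : List (Fin Q.nA × Bool)) (v v' : Fin Q.nV) : Prop :=
  Q.IsTrail w ∧ (∃ p, w.head? = some p ∧ (Q.stepEnds p).1 = v) ∧
    ∃ q, w.getLast? = some q ∧ (Q.stepEnds q).2 = v'

/-- The trail `w` visits the vertex `v`. -/
def Visits (w : List (Fin Q.nA × Bool)) (v : Fin Q.nV) : Prop :=
  ∃ p ∈ w, (Q.stepEnds p).1 = v ∨ (Q.stepEnds p).2 = v

/-- The vertex `v` lies on an (undirected) cycle of `Q`. -/
def OnCycle (v : Fin Q.nV) : Prop :=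
  ∃ w, w ≠ [] ∧ Q.TrailFromTo w v v

/-- The vertex `v` belongs to a cycle or to a trajectory joining two vertices belonging
to cycles. -/
def InCore (v : Fin Q.nV) : Prop :=
  Q.OnCycle v ∨
    ∃ v1 v2 w, Q.OnCycle v1 ∧ Q.OnCycle v2 ∧ Q.TrailFromTo w v1 v2 ∧ Q.Visits w v

/-- `Q` has a rooted tree of depth strictly greater than one: there are two adjacent
vertices outside the core. -/
def HasDeepRootedTree : Prop :=
  ∃ u1 u2 : Fin Q.nV, u1 ≠ u2 ∧ ¬ Q.InCore u1 ∧ ¬ Q.InCore u2 ∧ Q.adj u1 u2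

end FinQuiver

/-- A gentle algebra, presented combinatorially as a quiver with a set of length-two
monomial relations (`rel b a` means that the composition `b ∘ a` is a zero relation). -/
structure GentleAlg extends FinQuiver where
  rel : Fin nA → Fin nA → Prop
  rel_dec : DecidableRel rel
  rel_comp : ∀ b a, rel b a → src b = tgt a
  out_le_two : ∀ v, Nat.card {a : Fin nA // src a = v} ≤ 2
  in_le_two : ∀ v, Nat.card {a : Fin nA // tgt a = v} ≤ 2
  perm_pred_unique : ∀ b a a', src b = tgt a → ¬ rel b a → src b = tgt a' → ¬ rel b a' → a = a'
  perm_succ_unique : ∀ b c c', src c = tgt b → ¬ rel c b → src c' = tgt b → ¬ rel c' b → c = c'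
  rel_pred_unique : ∀ b a a', rel b a → rel b a' → a = a'
  rel_succ_unique : ∀ b c c', rel c b → rel c' b → c = c'
  no_perm_cycle : ∀ l : List (Fin nA), l ≠ [] →
    l.Chain' (fun a b => tgt a = src b ∧ ¬ rel b a) →
    ∀ h hl, l.head? = some h → l.getLast? = some hl → tgt hl = src h → rel h hl

namespace GentleAlg

variable (A : GentleAlg)

/-- A permitted path: consecutive arrows compose and no two consecutive arrows form a
zero relation. -/
def IsPermPath (l : List (Fin A.nA)) : Prop :=
  l.Chain' (fun a b => A.tgt a = A.src b ∧ ¬ A.rel b a)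

/-- A non-trivial permitted thread: a nonempty permitted path which is maximal. -/
def IsNontrivPermThread (l : List (Fin A.nA)) : Prop :=
  l ≠ [] ∧ A.IsPermPath l ∧ (∀ a, ¬ A.IsPermPath (a :: l)) ∧ ∀ a, ¬ A.IsPermPath (l ++ [a])

/-- The vertex `v` carries a trivial permitted thread. -/
def HasTrivPermThread (v : Fin A.nV) : Prop :=
  Nat.card {a : Fin A.nA // A.src a = v} ≤ 1 ∧ Nat.card {a : Fin A.nA // A.tgt a = v} ≤ 1 ∧
    ∀ b c, A.tgt b = v → A.src c = v → ¬ A.rel c b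

/-- The number of permitted threads (trivial and non-trivial) of `A`. -/
noncomputable def numPermThreads : ℕ :=
  Nat.card {l : List (Fin A.nA) // A.IsNontrivPermThread l} +
    Nat.card {v : Fin A.nV // A.HasTrivPermThread v}

/-- A forbidden path: pairwise distinct arrows, any two consecutive ones forming a zero
relation. -/
def IsForbPath (l : List (Fin A.nA)) : Prop :=
  l.Nodup ∧ l.Chain' (fun a b => A.rel b a)

/-- A non-trivial forbidden thread: a nonempty maximal forbidden path. -/
def IsNontrivForbThread (l : List (Fin A.nA)) : Prop :=
  l ≠ [] ∧ A.IsForbPath l ∧ (∀ a, ¬ A.IsForbPath (a :: l)) ∧ ∀ a, ¬ A.IsForbPath (l ++ [a])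

/-- The vertex `v` carries a trivial forbidden thread. -/
def HasTrivForbThread (v : Fin A.nV) : Prop :=
  Nat.card {a : Fin A.nA // A.src a = v} ≤ 1 ∧ Nat.card {a : Fin A.nA // A.tgt a = v} ≤ 1 ∧
    ∀ b c, A.tgt b = v → A.src c = v → A.rel c b

/-- The type of permitted threads of `A` (non-trivial ones and trivial ones). -/
abbrev PermThread : Type :=
  {l : List (Fin A.nA) // A.IsNontrivPermThread l} ⊕ {v : Fin A.nV // A.HasTrivPermThread v}

/-- The type of forbidden threads of `A` (non-trivial ones and trivial ones). -/
abbrev ForbThread : Type :=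
  {l : List (Fin A.nA) // A.IsNontrivForbThread l} ⊕ {v : Fin A.nV // A.HasTrivForbThread v}

/-- Start vertex of a permitted thread. -/
def pStart : A.PermThread → Fin A.nV
  | .inl l => A.src (l.1.head l.2.1)
  | .inr v => v.1

/-- End vertex of a permitted thread. -/
def pEnd : A.PermThread → Fin A.nV
  | .inl l => A.tgt (l.1.getLast l.2.1)
  | .inr v => v.1

/-- Start vertex of a forbidden thread. -/
def fStart : A.ForbThread → Fin A.nV
  | .inl l => A.src (l.1.head l.2.1)
  | .inr v => v.1

/-- End vertex of a forbidden thread. -/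
def fEnd : A.ForbThread → Fin A.nV
  | .inl l => A.tgt (l.1.getLast l.2.1)
  | .inr v => v.1

/-- The length (number of arrows) of a forbidden thread. -/
def forbLen : A.ForbThread → ℕ
  | .inl l => l.1.length
  | .inr _ => 0

/-- A full cycle of relations (contributing a pair `(0, m)` to the invariant). -/
def IsRelCycle (l : List (Fin A.nA)) : Prop :=
  l ≠ [] ∧ l.Nodup ∧ l.Chain' (fun a b => A.rel b a) ∧
    ∃ h hl, l.head? = some h ∧ l.getLast? = some hl ∧ A.rel h hl

end GentleAlg

/-- A choice of the sign functions `σ, ε : Q₁ → {1,-1}` of Butler–Ringel for a gentle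
algebra. -/
structure GentleAlg.Signs (G : GentleAlg) where
  sgn : Fin G.nA → Bool
  esgn : Fin G.nA → Bool
  sgn_src : ∀ a b, a ≠ b → G.src a = G.src b → sgn a ≠ sgn b
  esgn_tgt : ∀ a b, a ≠ b → G.tgt a = G.tgt b → esgn a ≠ esgn b
  sgn_comp : ∀ a b, G.src b = G.tgt a → ¬ G.rel b a → sgn b = ! esgn a

namespace GentleAlg.Signs

variable {G : GentleAlg} (S : G.Signs)

/-- The sign `σ` of the trivial permitted thread at a vertex. -/
noncomputable def pTrivSgn (v : Fin G.nV) : Bool :=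
  if h : ∃ c, G.src c = v then ! S.sgn h.choose
  else if h2 : ∃ b, G.tgt b = v then S.esgn h2.choose
  else false

/-- The sign `σ` of the trivial forbidden thread at a vertex. -/
noncomputable def fTrivSgn (v : Fin G.nV) : Bool :=
  if h : ∃ c, G.src c = v then ! S.sgn h.choose
  else if h2 : ∃ b, G.tgt b = v then ! S.esgn h2.choose
  else false

/-- The sign `σ` of a permitted thread. -/
noncomputable def pSgn : G.PermThread → Bool
  | .inl l => S.sgn (l.1.head l.2.1)
  | .inr v => S.pTrivSgn v.1

/-- The sign `ε` of a permitted thread. -/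
noncomputable def pEps : G.PermThread → Bool
  | .inl l => S.esgn (l.1.getLast l.2.1)
  | .inr v => ! S.pTrivSgn v.1

/-- The sign `σ` of a forbidden thread. -/
noncomputable def fSgn : G.ForbThread → Bool
  | .inl l => S.sgn (l.1.head l.2.1)
  | .inr v => S.fTrivSgn v.1

/-- The sign `ε` of a forbidden thread. -/
noncomputable def fEps : G.ForbThread → Bool
  | .inl l => S.esgn (l.1.getLast l.2.1)
  | .inr v => S.fTrivSgn v.1

end GentleAlg.Signs

/-- The pairing data of the Avella-Alaminos–Geiss algorithm: each permitted thread `H` is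
followed by the forbidden thread `forb H` ending where `H` ends (with opposite sign), and
the next permitted thread `next H` starts where `forb H` starts (with opposite sign). -/
structure GentleAlg.AGPairing (G : GentleAlg) (S : G.Signs) where
  next : G.PermThread → G.PermThread
  forb : G.PermThread → G.ForbThread
  next_bij : Function.Bijective next
  end_forb : ∀ H, G.fEnd (forb H) = G.pEnd H
  eps_forb : ∀ H, S.fEps (forb H) = ! S.pEps H
  start_next : ∀ H, G.pStart (next H) = G.fStart (forb H)
  sgn_next : ∀ H, S.pSgn (next H) = ! S.fSgn (forb H)

/-- The Avella-Alaminos–Geiss invariant `φ_A : ℕ × ℕ → ℕ` associated with a gentle algebra: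
`φ n m` is the number of orbits of the algorithm of size `n` whose forbidden threads use `m`
arrows in total (for `n = 0`, the number of full cycles of relations of length `m`). -/
noncomputable def GentleAlg.agPhi {G : GentleAlg} {S : G.Signs} (P : GentleAlg.AGPairing G S) :
    ℕ → ℕ → ℕ := fun n m =>
  if n = 0 then Nat.card {l : List (Fin G.nA) // G.IsRelCycle l ∧ l.length = m} / m
  else
    Nat.card {H : G.PermThread //
      Function.minimalPeriod P.next H = n ∧
        ∑ k ∈ Finset.range n, G.forbLen (P.forb (P.next^[k] H)) = m} / n

/-- `x` is a transition vertex with incoming arrow `α` and outgoing arrow `β`. -/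
def GentleAlg.TransitionAt (A : GentleAlg) (x : Fin A.nV) (α β : Fin A.nA) : Prop :=
  α ≠ β ∧ A.tgt α = x ∧ A.src β = x ∧ (∀ a, A.tgt a = x → a = α) ∧
    (∀ a, A.src a = x → a = β) ∧ ¬ A.rel β α

/-- `B` is the contraction `A ∖ {x}` of `A` at the transition vertex `x`, replacing the
arrows `α`, `β` by a single arrow (indexed by `none`). -/
def GentleAlg.IsContraction (A : GentleAlg) (x : Fin A.nV) (α β : Fin A.nA)
    (B : GentleAlg) : Prop :=
  ∃ (ev : {v : Fin A.nV // v ≠ x} ≃ Fin B.nV)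
    (ea : Option {a : Fin A.nA // a ≠ α ∧ a ≠ β} ≃ Fin B.nA),
    (∀ (a : {a : Fin A.nA // a ≠ α ∧ a ≠ β}) (h : A.src a.1 ≠ x),
        B.src (ea (some a)) = ev ⟨A.src a.1, h⟩) ∧
    (∀ (a : {a : Fin A.nA // a ≠ α ∧ a ≠ β}) (h : A.tgt a.1 ≠ x),
        B.tgt (ea (some a)) = ev ⟨A.tgt a.1, h⟩) ∧
    (∀ h : A.src α ≠ x, B.src (ea none) = ev ⟨A.src α, h⟩) ∧
    (∀ h : A.tgt β ≠ x, B.tgt (ea none) = ev ⟨A.tgt β, h⟩) ∧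
    (∀ b a, B.rel (ea (some b)) (ea (some a)) ↔ A.rel b.1 a.1) ∧
    (∀ b, B.rel (ea (some b)) (ea none) ↔ A.rel b.1 β) ∧
    (∀ a, B.rel (ea none) (ea (some a)) ↔ A.rel α a.1) ∧
    (B.rel (ea none) (ea none) ↔ A.rel α β)

/-- `x` is a degree-one vertex which is the start point of the arrow `θ`, where `θ` is
involved in a relation (case (2) of the removable-vertex definition). -/
def GentleAlg.DeletionAt (A : GentleAlg) (x : Fin A.nV) (θ : Fin A.nA) : Prop :=
  A.src θ = x ∧ (∀ a, A.src a = x → a = θ) ∧ (∀ a, A.tgt a ≠ x) ∧ ∃ κ, A.rel κ θ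

/-- `B` is obtained from `A` by deleting the degree-one vertex `x` and the arrow `θ`. -/
def GentleAlg.IsDeletion (A : GentleAlg) (x : Fin A.nV) (θ : Fin A.nA) (B : GentleAlg) : Prop :=
  ∃ (ev : {v : Fin A.nV // v ≠ x} ≃ Fin B.nV) (ea : {a : Fin A.nA // a ≠ θ} ≃ Fin B.nA),
    (∀ (a : {a : Fin A.nA // a ≠ θ}) (h : A.src a.1 ≠ x),
        B.src (ea a) = ev ⟨A.src a.1, h⟩) ∧
    (∀ (a : {a : Fin A.nA // a ≠ θ}) (h : A.tgt a.1 ≠ x),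
        B.tgt (ea a) = ev ⟨A.tgt a.1, h⟩) ∧
    ∀ b a, B.rel (ea b) (ea a) ↔ A.rel b.1 a.1

/-- `B` is obtained from `A` by removing a vertex `x` as in the contraction construction
(Definition of `A ∖ {x}`). -/
def GentleAlg.RemovableTo (A : GentleAlg) (x : Fin A.nV) (B : GentleAlg) : Prop :=
  (∃ α β, GentleAlg.TransitionAt A x α β ∧ GentleAlg.IsContraction A x α β B) ∨
    ∃ θ, GentleAlg.DeletionAt A x θ ∧ GentleAlg.IsDeletion A x θ B

/-- The configuration for the vertex transformation `V_i` (generic case). -/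
structure GentleAlg.VertexConfig (A : GentleAlg) where
  i : Fin A.nV
  j1 : Fin A.nV
  j2 : Fin A.nV
  s1 : Fin A.nV
  s2 : Fin A.nV
  p1 : Fin A.nV
  p2 : Fin A.nV
  α1 : Fin A.nA
  α2 : Fin A.nA
  σ1 : Fin A.nA
  σ2 : Fin A.nA
  π1 : Fin A.nA
  π2 : Fin A.nA
  hα1s : A.src α1 = i
  hα1t : A.tgt α1 = j1
  hα2s : A.src α2 = i
  hα2t : A.tgt α2 = j2
  hαne : α1 ≠ α2
  hj1 : j1 ≠ i
  hj2 : j2 ≠ i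
  hs1 : s1 ≠ i
  hs2 : s2 ≠ i
  hσ1s : A.src σ1 = j1
  hσ1t : A.tgt σ1 = s1
  hσ2s : A.src σ2 = j2
  hσ2t : A.tgt σ2 = s2
  hrσ1 : A.rel σ1 α1
  hrσ2 : A.rel σ2 α2
  hπ1s : A.src π1 = p1
  hπ1t : A.tgt π1 = i
  hπ2s : A.src π2 = p2
  hπ2t : A.tgt π2 = i
  hrπ1 : A.rel α1 π1
  hrπ2 : A.rel α2 π2

namespace GentleAlg.VertexConfig

variable {A : GentleAlg} (d : A.VertexConfig)

/-- Sources of the arrows after the vertex transformation. -/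
def newSrc : Fin A.nA → Fin A.nV := fun a =>
  if a = d.α1 then d.j1
  else if a = d.α2 then d.j2
  else if a = d.σ1 ∨ a = d.σ2 then d.i
  else if a = d.π1 then d.p2
  else if a = d.π2 then d.p1
  else A.src a

/-- Targets of the arrows after the vertex transformation. -/
def newTgt : Fin A.nA → Fin A.nV := fun a =>
  if a = d.α1 ∨ a = d.α2 then d.i
  else if a = d.π1 then d.j1
  else if a = d.π2 then d.j2
  else A.tgt a

/-- Relations after the vertex transformation. -/
def newRel : Fin A.nA → Fin A.nA → Prop := fun b a =>
  ((b = d.σ1 ∧ a = d.α2) ∨ (b = d.σ2 ∧ a = d.α1) ∨ (b = d.α1 ∧ a = d.π1) ∨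
      (b = d.α2 ∧ a = d.π2)) ∨
    (A.rel b a ∧
      ¬((b = d.σ1 ∧ a = d.α1) ∨ (b = d.σ2 ∧ a = d.α2) ∨ (b = d.α1 ∧ a = d.π1) ∨
        (b = d.α2 ∧ a = d.π2)))

end GentleAlg.VertexConfig

/-- `B` is the result of the vertex transformation `V_i` of `A` given by the
configuration `d`. -/
def GentleAlg.IsVertexTransform (A : GentleAlg) (d : A.VertexConfig) (B : GentleAlg) : Prop :=
  ∃ (hV : B.nV = A.nV) (hA : B.nA = A.nA),
    (∀ a : Fin A.nA, B.src (Fin.cast hA.symm a) = Fin.cast hV.symm (d.newSrc a)) ∧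
    (∀ a : Fin A.nA, B.tgt (Fin.cast hA.symm a) = Fin.cast hV.symm (d.newTgt a)) ∧
    ∀ b a : Fin A.nA, B.rel (Fin.cast hA.symm b) (Fin.cast hA.symm a) ↔ d.newRel b a

/-- The configuration for the arrow transformation `F_δ`. -/
structure GentleAlg.ArrowConfig (A : GentleAlg) where
  i : Fin A.nV
  j : Fin A.nV
  b : Fin A.nV
  c : Fin A.nV
  l : Fin A.nV
  x : Fin A.nV
  δ : Fin A.nA
  β : Fin A.nA
  γ : Fin A.nA
  lam : Fin A.nA
  ξ : Fin A.nA
  hij : i ≠ j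
  hδs : A.src δ = i
  hδt : A.tgt δ = j
  hβs : A.src β = b
  hβt : A.tgt β = i
  hγs : A.src γ = i
  hγt : A.tgt γ = c
  hlams : A.src lam = l
  hlamt : A.tgt lam = i
  hξs : A.src ξ = j
  hξt : A.tgt ξ = x
  hγδ : γ ≠ δ
  hβlam : β ≠ lam
  hrβ : A.rel δ β
  hrlam : A.rel γ lam
  hrξ : A.rel ξ δ
  /-- the separation condition `Q₀¹ ∩ Q₀² = ∅`: after removing `β` and `γ`, the vertices
  `b` and `c` are not connected to `i`. -/
  hsep1 : ¬ Relation.ReflTransGen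
    (A.toFinQuiver.adjOn ((Finset.univ.erase β).erase γ)) b i
  hsep2 : ¬ Relation.ReflTransGen
    (A.toFinQuiver.adjOn ((Finset.univ.erase β).erase γ)) c i

namespace GentleAlg.ArrowConfig

variable {A : GentleAlg} (d : A.ArrowConfig)

/-- Sources of the arrows after the arrow transformation. -/
def newSrc : Fin A.nA → Fin A.nV := fun a =>
  if a = d.δ then d.j else if a = d.ξ then d.i else A.src a

/-- Targets of the arrows after the arrow transformation. -/
def newTgt : Fin A.nA → Fin A.nV := fun a =>
  if a = d.δ then d.i else if a = d.lam then d.j else A.tgt a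

/-- Relations after the arrow transformation. -/
def newRel : Fin A.nA → Fin A.nA → Prop := fun b' a =>
  ((b' = d.γ ∧ a = d.δ) ∨ (b' = d.ξ ∧ a = d.β) ∨ (b' = d.δ ∧ a = d.lam)) ∨
    (A.rel b' a ∧
      ¬((b' = d.δ ∧ a = d.β) ∨ (b' = d.γ ∧ a = d.lam) ∨ (b' = d.ξ ∧ a = d.δ)))

end GentleAlg.ArrowConfig

/-- `B` is the result of the arrow transformation `F_δ` of `A` given by the
configuration `d`. -/
def GentleAlg.IsArrowTransform (A : GentleAlg) (d : A.ArrowConfig) (B : GentleAlg) : Prop :=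
  ∃ (hV : B.nV = A.nV) (hA : B.nA = A.nA),
    (∀ a : Fin A.nA, B.src (Fin.cast hA.symm a) = Fin.cast hV.symm (d.newSrc a)) ∧
    (∀ a : Fin A.nA, B.tgt (Fin.cast hA.symm a) = Fin.cast hV.symm (d.newTgt a)) ∧
    ∀ b a : Fin A.nA, B.rel (Fin.cast hA.symm b) (Fin.cast hA.symm a) ↔ d.newRel b a

/-- The configuration for the loop transformation `L_λ`. -/
structure GentleAlg.LoopConfig (A : GentleAlg) where
  i : Fin A.nV
  j : Fin A.nV
  l : Fin A.nV
  x : Fin A.nV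
  lam : Fin A.nA
  α : Fin A.nA
  δ : Fin A.nA
  ξ : Fin A.nA
  hij : i ≠ j
  hlams : A.src lam = i
  hlamt : A.tgt lam = i
  hαs : A.src α = l
  hαt : A.tgt α = i
  hδs : A.src δ = i
  hδt : A.tgt δ = j
  hξs : A.src ξ = j
  hξt : A.tgt ξ = x
  hαlam : α ≠ lam
  hδlam : δ ≠ lam
  hrα : A.rel δ α
  hrξ : A.rel ξ δ

namespace GentleAlg.LoopConfig

variable {A : GentleAlg} (d : A.LoopConfig)

/-- Sources of the arrows after the loop transformation. -/
def newSrc : Fin A.nA → Fin A.nV := fun a =>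
  if a = d.δ then d.j else if a = d.ξ then d.i else A.src a

/-- Targets of the arrows after the loop transformation. -/
def newTgt : Fin A.nA → Fin A.nV := fun a =>
  if a = d.α then d.j else if a = d.δ then d.i else A.tgt a

end GentleAlg.LoopConfig

/-- `B` is the result of the loop transformation `L_λ` of `A` given by the
configuration `d`. -/
def GentleAlg.IsLoopTransform (A : GentleAlg) (d : A.LoopConfig) (B : GentleAlg) : Prop :=
  ∃ (hV : B.nV = A.nV) (hA : B.nA = A.nA),
    (∀ a : Fin A.nA, B.src (Fin.cast hA.symm a) = Fin.cast hV.symm (d.newSrc a)) ∧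
    (∀ a : Fin A.nA, B.tgt (Fin.cast hA.symm a) = Fin.cast hV.symm (d.newTgt a)) ∧
    ∀ b a : Fin A.nA, B.rel (Fin.cast hA.symm b) (Fin.cast hA.symm a) ↔ A.rel b a

/-- `B` is obtained from `A` by a single elementary transformation (over a vertex, an
arrow or a loop). -/
def GentleAlg.ElemMove (A B : GentleAlg) : Prop :=
  (∃ d : A.VertexConfig, GentleAlg.IsVertexTransform A d B) ∨
    (∃ d : A.ArrowConfig, GentleAlg.IsArrowTransform A d B) ∨
    ∃ d : A.LoopConfig, GentleAlg.IsLoopTransform A d B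

/-- `A` and `B` are derived equivalent under elementary transformations: `B` is obtained
from `A` by a finite sequence of elementary transformations and their inverses. -/
def GentleAlg.ElemEquiv (A B : GentleAlg) : Prop :=
  Relation.ReflTransGen (fun X Y => GentleAlg.ElemMove X Y ∨ GentleAlg.ElemMove Y X) A B

/-- The defining relations of the algebra `kQ/⟨P⟩` inside the free algebra on the
idempotents (vertices) and the arrows. -/
inductive GentleAlg.PathRel (G : GentleAlg) :
    FreeAlgebra ℚ (Fin G.nV ⊕ Fin G.nA) → FreeAlgebra ℚ (Fin G.nV ⊕ Fin G.nA) → Prop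
  | idem (v : Fin G.nV) :
      GentleAlg.PathRel G (FreeAlgebra.ι ℚ (Sum.inl v) * FreeAlgebra.ι ℚ (Sum.inl v))
        (FreeAlgebra.ι ℚ (Sum.inl v))
  | orth (v w : Fin G.nV) : v ≠ w →
      GentleAlg.PathRel G (FreeAlgebra.ι ℚ (Sum.inl v) * FreeAlgebra.ι ℚ (Sum.inl w)) 0
  | unit :
      GentleAlg.PathRel G (∑ v : Fin G.nV, FreeAlgebra.ι ℚ (Sum.inl v)) 1
  | left_id (a : Fin G.nA) :
      GentleAlg.PathRel G (FreeAlgebra.ι ℚ (Sum.inl (G.tgt a)) * FreeAlgebra.ι ℚ (Sum.inr a))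
        (FreeAlgebra.ι ℚ (Sum.inr a))
  | right_id (a : Fin G.nA) :
      GentleAlg.PathRel G (FreeAlgebra.ι ℚ (Sum.inr a) * FreeAlgebra.ι ℚ (Sum.inl (G.src a)))
        (FreeAlgebra.ι ℚ (Sum.inr a))
  | left_ann (v : Fin G.nV) (a : Fin G.nA) : v ≠ G.tgt a →
      GentleAlg.PathRel G (FreeAlgebra.ι ℚ (Sum.inl v) * FreeAlgebra.ι ℚ (Sum.inr a)) 0
  | right_ann (v : Fin G.nV) (a : Fin G.nA) : v ≠ G.src a →
      GentleAlg.PathRel G (FreeAlgebra.ι ℚ (Sum.inr a) * FreeAlgebra.ι ℚ (Sum.inl v)) 0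
  | zero_rel (b a : Fin G.nA) : G.rel b a →
      GentleAlg.PathRel G (FreeAlgebra.ι ℚ (Sum.inr b) * FreeAlgebra.ι ℚ (Sum.inr a)) 0

/-- The gentle algebra `kQ/⟨P⟩` as an actual ring (over `k = ℚ`). -/
def GentleAlg.kAlg (G : GentleAlg) : Type := RingQuot (GentleAlg.PathRel G)

noncomputable instance (G : GentleAlg) : Ring (GentleAlg.kAlg G) :=
  inferInstanceAs (Ring (RingQuot (GentleAlg.PathRel G)))

/-- Two rings are derived equivalent if their derived categories of modules are
equivalent. -/
def DerivedEquiv (R S : Type) [Ring R] [Ring S] : Prop :=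
  letI : HasDerivedCategory (ModuleCat.{0} R) := HasDerivedCategory.standard _
  letI : HasDerivedCategory (ModuleCat.{0} S) := HasDerivedCategory.standard _
  Nonempty (DerivedCategory (ModuleCat.{0} R) ≌ DerivedCategory (ModuleCat.{0} S))

/-- `A` is (isomorphic to) the gentle algebra with `n` vertices, `m` arrows, sources `s`,
targets `t` and relations `r`. -/
def GentleAlg.MatchesData (A : GentleAlg) (n m : ℕ) (s t : Fin m → Fin n)
    (r : Fin m → Fin m → Prop) : Prop :=
  ∃ (hV : A.nV = n) (hA : A.nA = m),
    (∀ a : Fin m, A.src (Fin.cast hA.symm a) = Fin.cast hV.symm (s a)) ∧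
    (∀ a : Fin m, A.tgt (Fin.cast hA.symm a) = Fin.cast hV.symm (t a)) ∧
    ∀ b a : Fin m, A.rel (Fin.cast hA.symm b) (Fin.cast hA.symm a) ↔ r b a

/-- The number of nonzero paths from `y` to `x` in the gentle algebra `A` (including the
trivial path when `x = y`). -/
noncomputable def GentleAlg.numPaths (A : GentleAlg) (x y : Fin A.nV) : ℕ :=
  Nat.card {l : List (Fin A.nA) // A.IsPermPath l ∧
    ((l = [] ∧ x = y) ∨
      ∃ h hl, l.head? = some h ∧ l.getLast? = some hl ∧ A.src h = y ∧ A.tgt hl = x)}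

/-- Isomorphism of gentle algebras (as quivers with relations). -/
def GentleAlg.Iso (A B : GentleAlg) : Prop :=
  ∃ (ev : Fin A.nV ≃ Fin B.nV) (ea : Fin A.nA ≃ Fin B.nA),
    (∀ a, B.src (ea a) = ev (A.src a)) ∧ (∀ a, B.tgt (ea a) = ev (A.tgt a)) ∧
      ∀ b a, B.rel (ea b) (ea a) ↔ A.rel b a

/-- A perfect matching of `[2n]`, encoded as a fixed-point-free involution. -/
def PerfectMatching (n : ℕ) : Type :=
  {f : Equiv.Perm (Fin (2 * n)) // ∀ i, f i ≠ i ∧ f (f i) = i}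

/-- The equivalence relation generated by `r` and the pair `(x, y)`. -/
def Setoid.glue {D : Type*} (r : Setoid D) (x y : D) : Setoid D where
  r d e := r d e ∨ (r d x ∧ r y e) ∨ (r d y ∧ r x e)
  iseqv :=
    { refl := fun d => Or.inl (r.refl d)
      symm := by
        rintro d e (h | ⟨h, h'⟩ | ⟨h, h'⟩)
        · exact Or.inl (r.symm h)
        · exact Or.inr (Or.inr ⟨r.symm h', r.symm h⟩)
        · exact Or.inr (Or.inl ⟨r.symm h', r.symm h⟩)
      trans := by
        rintro d e f (h | ⟨h, h'⟩ | ⟨h, h'⟩) (k | ⟨k, k'⟩ | ⟨k, k'⟩)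
        · exact Or.inl (r.trans h k)
        · exact Or.inr (Or.inl ⟨r.trans h k, k'⟩)
        · exact Or.inr (Or.inr ⟨r.trans h k, k'⟩)
        · exact Or.inr (Or.inl ⟨h, r.trans h' k⟩)
        · exact Or.inr (Or.inl ⟨h, k'⟩)
        · exact Or.inl (r.trans h k')
        · exact Or.inr (Or.inr ⟨h, r.trans h' k⟩)
        · exact Or.inl (r.trans h k')
        · exact Or.inr (Or.inr ⟨h, k'⟩) }

namespace Setoid

variable {D : Type*}

theorem le_glue (r : Setoid D) (x y : D) : r ≤ r.glue x y := fun _ _ h => Or.inl h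

theorem glue_rel (r : Setoid D) (x y : D) : r.glue x y x y :=
  Or.inr (Or.inl ⟨r.refl x, r.refl y⟩)

theorem glue_le {r s : Setoid D} {x y : D} (h : r ≤ s) (hxy : s x y) : r.glue x y ≤ s := by
  rintro d e (k | ⟨k, k'⟩ | ⟨k, k'⟩)
  · exact h k
  · exact s.trans (h k) (s.trans hxy (h k'))
  · exact s.trans (h k) (s.trans (s.symm hxy) (h k'))

theorem natCard_quotient_anti [Finite D] {r s : Setoid D} (h : r ≤ s) :
    Nat.card (Quotient s) ≤ Nat.card (Quotient r) :=
  Nat.card_le_card_of_surjective (Quotient.map' id h) (by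
    rintro ⟨d⟩
    exact ⟨Quotient.mk r d, rfl⟩)

theorem natCard_quotient_le_glue [Finite D] (r : Setoid D) (x y : D) :
    Nat.card (Quotient r) ≤ Nat.card (Quotient (r.glue x y)) + 1 := by
  classical
  rw [← Finite.card_option]
  refine Nat.card_le_card_of_injective (Quotient.lift (s := r)
    (fun d => if r d y then none else some (Quotient.mk (r.glue x y) d)) ?_) ?_
  · intro d e h
    have hiff : r d y ↔ r e y := ⟨r.trans (r.symm h), r.trans h⟩
    by_cases hd : r d y
    · simp [hd, hiff.1 hd]
    · have he : ¬ r e y := fun k => hd (hiff.2 k)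
      simp only [hd, he, if_false]
      exact congrArg some (Quotient.sound (le_glue r x y h))
  · rintro ⟨d⟩ ⟨e⟩ h
    apply Quotient.sound
    change (if r d y then none else some (Quotient.mk (r.glue x y) d)) =
      (if r e y then none else some (Quotient.mk (r.glue x y) e)) at h
    by_cases hd : r d y <;> by_cases he : r e y <;> simp only [hd, he, if_true, if_false] at h
    · exact r.trans hd (r.symm he)
    · cases h
    · cases h
    · rcases Quotient.exact (Option.some.inj h) with k | ⟨-, k⟩ | ⟨k, -⟩
      · exact k
      · exact absurd (r.symm k) he
      · exact absurd k hd

theorem natCard_quotient_glue_lt [Finite D] {r : Setoid D} {x y : D} (h : ¬ r x y) :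
    Nat.card (Quotient (r.glue x y)) < Nat.card (Quotient r) := by
  refine lt_of_le_of_ne (natCard_quotient_anti (le_glue r x y)) fun heq => h ?_
  have hsurj : Surjective (Quotient.map' (s₁ := r) (s₂ := r.glue x y) id (le_glue r x y)) := by
    rintro ⟨d⟩
    exact ⟨Quotient.mk r d, rfl⟩
  have hinj := ((Nat.bijective_iff_surjective_and_card _).2 ⟨hsurj, heq.symm⟩).injective
  exact Quotient.exact (hinj (Quotient.sound (glue_rel r x y) :
    Quotient.map' (s₁ := r) (s₂ := r.glue x y) id (le_glue r x y) (Quotient.mk r x) =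
      Quotient.map' (s₁ := r) (s₂ := r.glue x y) id (le_glue r x y) (Quotient.mk r y)))

end Setoid

namespace Equiv.Perm

variable {D : Type*}

/-- The number of cycles of a permutation, fixed points included. -/
noncomputable def numOrbits (ρ : Perm D) : ℕ := Nat.card (Quotient (SameCycle.setoid ρ))

theorem sameCycle_setoid_le {ρ : Perm D} {r : Setoid D} (h : ∀ d, r d (ρ d)) :
    SameCycle.setoid ρ ≤ r := by
  rintro d e ⟨n, rfl⟩
  induction n with
  | zero => exact r.refl _
  | succ n ih =>
    rw [add_comm, zpow_add, mul_apply, zpow_one]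
    exact r.trans ih (h _)
  | pred n ih =>
    refine r.trans ih (r.symm ?_)
    convert h _ using 1
    rw [← mul_apply, ← zpow_one_add]
    congr 2
    ring

theorem sameCycle_setoid_swap_mul_le [DecidableEq D] {ρ : Perm D} {r : Setoid D}
    (h : SameCycle.setoid ρ ≤ r) (x y : D) : SameCycle.setoid (swap x y * ρ) ≤ r.glue x y := by
  refine sameCycle_setoid_le fun d => ?_
  have hd : r.glue x y d (ρ d) := Setoid.le_glue r x y (h ⟨1, rfl⟩)
  rw [mul_apply, swap_apply_def]
  split_ifs with h1 h2
  · exact Setoid.trans' _ (h1 ▸ hd) (Setoid.glue_rel r x y)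
  · exact Setoid.trans' _ (h2 ▸ hd) (Setoid.symm' _ (Setoid.glue_rel r x y))
  · exact hd

theorem numOrbits_eq [Fintype D] [DecidableEq D] (ρ : Perm D) :
    numOrbits ρ + ρ.support.card = Fintype.card D + ρ.cycleType.card := by
  classical
  have e : Quotient (SameCycle.setoid ρ) ≃ ρ.cycleFactorsFinset ⊕ {d // d ∉ ρ.support} := by
    refine (Equiv.ofBijective (Sum.elim (fun c => ?_) (fun d => Quotient.mk _ d.1)) ?_).symm
    · exact Quotient.mk _ (mem_cycleFactorsFinset_iff.1 c.2).1.nonempty_support.choose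
    have hc : ∀ c : ρ.cycleFactorsFinset,
        ρ.cycleOf (mem_cycleFactorsFinset_iff.1 c.2).1.nonempty_support.choose = c.1 := fun c =>
      (cycle_is_cycleOf (mem_cycleFactorsFinset_iff.1 c.2).1.nonempty_support.choose_spec c.2).symm
    constructor
    · rintro (c | d) (c' | d') h
      · have h' := Quotient.exact h
        have := SameCycle.cycleOf_eq h'
        rw [hc, hc] at this
        exact congrArg Sum.inl (Subtype.ext this)
      · have h' := SameCycle.cycleOf_eq (Quotient.exact h)
        have h2 := d'.2
        rw [hc, (cycleOf_eq_one_iff ρ).2 (notMem_support.1 h2)] at h'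
        exact absurd h' (mem_cycleFactorsFinset_iff.1 c.2).1.ne_one
      · have h' := SameCycle.cycleOf_eq (Quotient.exact h)
        have h2 := d.2
        rw [hc, (cycleOf_eq_one_iff ρ).2 (notMem_support.1 h2)] at h'
        exact absurd h'.symm (mem_cycleFactorsFinset_iff.1 c'.2).1.ne_one
      · obtain ⟨n, hn⟩ : ρ.SameCycle d.1 d'.1 := Quotient.exact h
        rw [zpow_apply_eq_self_of_apply_eq_self (notMem_support.1 d.2)] at hn
        exact congrArg Sum.inr (Subtype.ext hn)
    · rintro ⟨d⟩
      by_cases hd : d ∈ ρ.support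
      · let c : ρ.cycleFactorsFinset := ⟨_, cycleOf_mem_cycleFactorsFinset_iff.2 hd⟩
        refine ⟨Sum.inl c, Quotient.sound ?_⟩
        have h1 := (mem_cycleFactorsFinset_iff.1 c.2).1.nonempty_support.choose_spec
        exact (mem_support_cycleOf_iff.1 h1).1.symm
      · exact ⟨Sum.inr ⟨d, hd⟩, rfl⟩
  rw [numOrbits, Nat.card_congr e, Nat.card_sum, Nat.card_eq_fintype_card,
    Nat.card_eq_fintype_card, Fintype.card_coe, Fintype.card_subtype_compl, Fintype.card_coe,
    cycleType_def, Multiset.card_map, Finset.card_val]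
  have := ρ.support.card_le_univ
  omega

theorem sign_eq_numOrbits [Fintype D] [DecidableEq D] (ρ : Perm D) :
    sign ρ = (-1) ^ (Fintype.card D + numOrbits ρ) := by
  rw [sign_of_cycleType, sum_cycleType]
  have h := numOrbits_eq ρ
  refine neg_one_pow_congr ?_
  rw [Nat.even_iff, Nat.even_iff]
  omega

theorem numOrbits_swap_mul_mod_two [Fintype D] [DecidableEq D] (ρ : Perm D) {x y : D}
    (hxy : x ≠ y) : (numOrbits (swap x y * ρ) + numOrbits ρ) % 2 = 1 := by
  have h : sign (swap x y * ρ) = - sign ρ := by rw [sign_mul, sign_swap hxy, neg_one_mul]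
  rw [sign_eq_numOrbits, sign_eq_numOrbits] at h
  by_contra hne
  have h2 : (-1 : ℤˣ) ^ (Fintype.card D + numOrbits (swap x y * ρ)) =
      (-1) ^ (Fintype.card D + numOrbits ρ) := by
    refine neg_one_pow_congr ?_
    rw [Nat.even_iff, Nat.even_iff]
    omega
  rw [h2] at h
  exact units_ne_neg_self _ h

theorem numOrbits_swap_mul_le [Fintype D] [DecidableEq D] (ρ : Perm D) (x y : D) :
    numOrbits (swap x y * ρ) ≤
      Nat.card (Quotient ((SameCycle.setoid ρ).glue x y)) + 1 := by
  refine (Setoid.natCard_quotient_le_glue _ x y).trans ?_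
  gcongr
  apply Setoid.natCard_quotient_anti
  refine Setoid.glue_le ?_ (Setoid.glue_rel _ _ _)
  have := sameCycle_setoid_swap_mul_le (le_refl (SameCycle.setoid (swap x y * ρ))) x y
  rwa [← mul_assoc, swap_mul_self, one_mul] at this

/-- Multiplying by a transposition: the inductive step of the genus inequality. -/
theorem numOrbits_swap_mul_genus [Fintype D] [DecidableEq D] {ρ : Perm D} {r : Setoid D}
    (hr : SameCycle.setoid ρ ≤ r) {x y : D} (hxy : x ≠ y) {N k : ℕ}
    (h : numOrbits ρ + N ≤ 2 * Nat.card (Quotient r) + k) :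
    numOrbits (swap x y * ρ) + N ≤ 2 * Nat.card (Quotient (r.glue x y)) + (k + 1) := by
  have hpar := numOrbits_swap_mul_mod_two ρ hxy
  have hle := numOrbits_swap_mul_le ρ x y
  by_cases hrxy : r x y
  · have h1 := Setoid.natCard_quotient_anti (Setoid.glue_le le_rfl hrxy)
    have h2 := Setoid.natCard_quotient_anti (Setoid.le_glue (SameCycle.setoid ρ) x y)
    change _ ≤ numOrbits ρ at h2
    omega
  · have h1 := Setoid.natCard_quotient_le_glue r x y
    have h2 := Setoid.natCard_quotient_glue_lt
      (r := SameCycle.setoid ρ) (x := x) (y := y) fun h => hrxy (hr h)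
    change _ < numOrbits ρ at h2
    omega

end Equiv.Perm

namespace Equiv.Perm

variable {D : Type*}

theorem exists_closing_perm {A : Type*} [Fintype D] [DecidableEq D] (ι : Perm D) {s t : A → D}
    (hs : Function.Injective s) (ht : Function.Injective t) (hwf : WellFounded fun a b => t a = s b)
    (S : Finset A) :
    ∃ (σ : Perm D) (r : Setoid D), (∀ a ∈ S, σ (s a) = t a) ∧
      (∀ d, (∀ a ∈ S, d ≠ s a) →
        Relation.ReflTransGen (fun x y => ∃ a ∈ S, s a = x ∧ t a = y) (σ d) d) ∧
      SameCycle.setoid (ι * σ) ≤ r ∧ SameCycle.setoid ι ≤ r ∧ (∀ a ∈ S, r (s a) (t a)) ∧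
      numOrbits (ι * σ) + numOrbits ι ≤ 2 * Nat.card (Quotient r) + S.card ∧
      (numOrbits (ι * σ) + numOrbits ι + S.card) % 2 = 0 := by
  classical
  induction hn : S.card generalizing S with
  | zero =>
    obtain rfl := Finset.card_eq_zero.1 hn
    refine ⟨1, SameCycle.setoid ι, by simp, fun d _ => .refl, ?_, le_rfl, by simp, ?_, ?_⟩
    · rw [mul_one]
    · rw [mul_one, numOrbits]
      omega
    · rw [mul_one]
      omega
  | succ n ih =>
    obtain ⟨a, ha, hmin⟩ := hwf.has_min (S : Set A) (by
      rw [Finset.coe_nonempty, ← Finset.card_pos]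
      omega)
    have ha : a ∈ S := ha
    obtain ⟨σ, r, h1, h2, h3, h4, h5, h6, h7⟩ := ih (S.erase a) (by
      rw [Finset.card_erase_of_mem ha, hn]
      rfl)
    have hne : s a ≠ t a := fun h => hmin a ha h.symm
    have hfix : σ (s a) = s a := by
      rcases Relation.ReflTransGen.cases_tail (h2 (s a) fun b hb h =>
        (Finset.mem_erase.1 hb).1 (hs h).symm) with h | ⟨_, -, b, hb, -, h⟩
      · exact h.symm
      · exact absurd h (hmin b (Finset.mem_of_mem_erase hb))
    have hmul : ι * (swap (s a) (t a) * σ) = swap (ι (s a)) (ι (t a)) * (ι * σ) := by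
      rw [← mul_assoc, mul_swap_eq_swap_mul, mul_assoc]
    have hι : ∀ d, r d (ι d) := fun d => h4 ⟨1, rfl⟩
    refine ⟨swap (s a) (t a) * σ, r.glue (ι (s a)) (ι (t a)), ?_, ?_, ?_, ?_, ?_, ?_, ?_⟩
    · intro b hb
      rw [mul_apply]
      rcases eq_or_ne b a with rfl | hba
      · rw [hfix, swap_apply_left]
      · rw [h1 b (Finset.mem_erase.2 ⟨hba, hb⟩), swap_apply_of_ne_of_ne (hmin b hb) (ht.ne hba)]
    · intro d hd
      have hrt : Relation.ReflTransGen (fun x y => ∃ a ∈ S, s a = x ∧ t a = y) (σ d) d :=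
        Relation.ReflTransGen.mono
          (fun x y ⟨b, hb, h⟩ => ⟨b, Finset.mem_of_mem_erase hb, h⟩) _ _
          (h2 d fun b hb => hd b (Finset.mem_of_mem_erase hb))
      rw [mul_apply]
      have hsa : σ d ≠ s a := fun h => hd a ha (σ.injective (h.trans hfix.symm))
      rcases eq_or_ne (σ d) (t a) with hta | hta
      · rw [hta, swap_apply_right]
        exact .head ⟨a, ha, rfl, rfl⟩ (hta ▸ hrt)
      · rwa [swap_apply_of_ne_of_ne hsa hta]
    · rw [hmul]
      exact sameCycle_setoid_swap_mul_le h3 _ _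
    · exact h4.trans (Setoid.le_glue _ _ _)
    · intro b hb
      rcases eq_or_ne b a with rfl | hba
      · exact Setoid.trans' _ (Setoid.le_glue _ _ _ (hι _))
          (Setoid.trans' _ (Setoid.glue_rel _ _ _)
            (Setoid.symm' _ (Setoid.le_glue _ _ _ (hι _))))
      · exact Setoid.le_glue _ _ _ (h5 b (Finset.mem_erase.2 ⟨hba, hb⟩))
    · rw [hmul]
      exact numOrbits_swap_mul_genus h3 (ι.injective.ne hne) h6
    · rw [hmul]
      have := numOrbits_swap_mul_mod_two (ι * σ) (ι.injective.ne hne)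
      omega

open Classical in
/-- The values of a function at one representative of each cycle of a permutation. -/
noncomputable def orbitValues {β : Type*} [Finite D] (π : Perm D) (f : D → β) : Multiset β :=
  letI := Fintype.ofFinite (Quotient (SameCycle.setoid π))
  (Finset.univ : Finset (Quotient (SameCycle.setoid π))).val.map fun q => f q.out

theorem card_orbitValues {β : Type*} [Finite D] (π : Perm D) (f : D → β) :
    (orbitValues π f).card = numOrbits π := by
  let _ := Fintype.ofFinite (Quotient (SameCycle.setoid π))
  rw [orbitValues, Multiset.card_map, Finset.card_val, numOrbits, Finset.card_univ,
    Nat.card_eq_fintype_card]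

theorem exists_of_mem_orbitValues {β : Type*} [Finite D] {π : Perm D}
    {f : D → β} {b : β} (h : b ∈ orbitValues π f) : ∃ x, f x = b := by
  obtain ⟨q, -, hq⟩ := Multiset.mem_map.1 h
  exact ⟨_, hq⟩

theorem natCard_fiber_eq_mul_count {β : Type*} [DecidableEq β] [Finite D] (π : Perm D) (f : D → β)
    (hf : ∀ x, f (π x) = f x) (b : β) (n : ℕ) (hn : ∀ x, f x = b → minimalPeriod π x = n) :
    Nat.card {x // f x = b} = n * (orbitValues π f).count b := by
  classical
  let _ := Fintype.ofFinite D
  let _ := Fintype.ofFinite (Quotient (SameCycle.setoid π))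
  have hSC : ∀ {x y}, π.SameCycle x y → f x = f y := fun {x y} h =>
    sameCycle_setoid_le (r := Setoid.ker f) (fun d => (hf d).symm) h
  rw [orbitValues, Multiset.count_map, Nat.card_eq_fintype_card, Fintype.card_subtype]
  rw [show Multiset.filter (fun q : Quotient (SameCycle.setoid π) => b = f q.out)
      (Finset.univ : Finset (Quotient (SameCycle.setoid π))).val =
    (Finset.univ.filter fun q : Quotient (SameCycle.setoid π) => b = f q.out).val by
      simp only [Finset.filter_val], Finset.card_val]
  rw [Finset.card_eq_sum_card_fiberwise (f := Quotient.mk (SameCycle.setoid π))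
    (t := Finset.univ.filter fun q => b = f q.out)]
  · rw [Finset.sum_const_nat (m := n), mul_comm]
    intro q hq
    have hq : b = f q.out := (Finset.mem_filter.1 hq).2
    have hper : minimalPeriod π q.out = n := hn _ hq.symm
    rw [show (Finset.univ.filter fun x => f x = b).filter (fun x => Quotient.mk _ x = q) =
      (Finset.range n).image fun k => π^[k] q.out from ?_, Finset.card_image_of_injOn,
      Finset.card_range]
    · subst hper
      intro i hi j hj h
      exact iterate_injOn_Iio_minimalPeriod (Finset.mem_range.1 hi) (Finset.mem_range.1 hj) h
    · ext x
      simp only [Finset.mem_filter, Finset.mem_univ, true_and, Finset.mem_image, Finset.mem_range]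
      constructor
      · rintro ⟨-, hx⟩
        have hsc : π.SameCycle q.out x := Quotient.exact (q.out_eq.trans hx.symm)
        obtain ⟨k, hk⟩ := hsc.exists_nat_pow_eq
        refine ⟨k % n, Nat.mod_lt _ ?_, ?_⟩
        · rw [← hper]
          exact minimalPeriod_pos_of_mem_periodicPts (π.injective.mem_periodicPts _)
        · rw [← hper, iterate_mod_minimalPeriod_eq, ← hk, iterate_eq_pow]
      · rintro ⟨k, -, rfl⟩
        have hsc : π.SameCycle q.out (π^[k] q.out) := ⟨k, by rw [iterate_eq_pow, zpow_natCast]⟩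
        exact ⟨(hSC hsc).symm.trans hq.symm, (Quotient.sound hsc).symm.trans q.out_eq⟩
  · intro x hx
    have hx : f x = b := (Finset.mem_filter.1 hx).2
    refine Finset.mem_coe.2 (Finset.mem_filter.2 ⟨Finset.mem_univ _, ?_⟩)
    rw [← hx]
    have hsc : π.SameCycle (Quotient.mk (SameCycle.setoid π) x).out x :=
      Quotient.exact (s := SameCycle.setoid π) (Quotient.out_eq _)
    exact (hSC hsc).symm

/-- The points whose whole cycle is contained in a given set. -/
abbrev CyclicPart (φ : Perm D) (s : Set D) : Type _ := {d // ∀ e, φ.SameCycle d e → e ∈ s}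

/-- The restriction of a permutation to the cycles contained in a given set. -/
def cyclicPartPerm (φ : Perm D) (s : Set D) : Perm (CyclicPart φ s) :=
  φ.subtypePerm fun d => by
    have h : φ.SameCycle d (φ d) := ⟨1, rfl⟩
    exact ⟨fun k e he => k e (h.symm.trans he), fun k e he => k e (h.trans he)⟩

theorem cyclicPartPerm_iterate (φ : Perm D) (s : Set D) (k : ℕ) (z : CyclicPart φ s) :
    ((cyclicPartPerm φ s)^[k] z).1 = φ^[k] z.1 := by
  induction k with
  | zero => rfl
  | succ k ih =>
    rw [iterate_succ_apply', iterate_succ_apply', ← ih]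
    rfl

theorem minimalPeriod_cyclicPartPerm (φ : Perm D) (s : Set D) (z : CyclicPart φ s) :
    minimalPeriod (cyclicPartPerm φ s) z = minimalPeriod φ z.1 := by
  rw [minimalPeriod_eq_minimalPeriod_iff]
  intro n
  rw [IsPeriodicPt, IsPeriodicPt, IsFixedPt, IsFixedPt, ← cyclicPartPerm_iterate, Subtype.ext_iff]

/-- If `next` is the inverse of the first return map of `φ` to the complement of `s`, then every
cycle of `φ` either comes from a cycle of `next` or is contained in `s`. -/
theorem numOrbits_eq_add_cyclicPart {H : Type*} [Finite D] {φ : Perm D} {s : Set D}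
    {e : H → D} (he : Function.Injective e) (hes : ∀ x, e x ∉ s) (hse : ∀ d, d ∉ s → ∃ x, e x = d)
    {next : Perm H} {len : H → ℕ} (hret : ∀ x, φ^[len x + 1] (e (next x)) = e x)
    (hfirst : ∀ x k, k < len x → φ^[k + 1] (e (next x)) ∈ s) :
    numOrbits φ = numOrbits next + numOrbits (cyclicPartPerm φ s) := by
  have : Finite H := Finite.of_injective e he
  have hit : ∀ k d, φ.SameCycle d (φ^[k] d) := fun k d =>
    ⟨k, by rw [iterate_eq_pow, zpow_natCast]⟩
  have hnext : SameCycle.setoid next ≤ (SameCycle.setoid φ).comap e :=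
    sameCycle_setoid_le fun x => by
      have := (hit (len x + 1) (e (next x))).symm
      rwa [hret] at this
  have hpart : SameCycle.setoid (cyclicPartPerm φ s) ≤ (SameCycle.setoid φ).comap Subtype.val :=
    sameCycle_setoid_le fun z => hit 1 z.1
  have hback : ∀ n x y, φ^[n] (e x) = e y → next.SameCycle x y := by
    intro n
    induction n using Nat.strong_induction_on with
    | _ n ih =>
      intro x y h
      obtain ⟨w, rfl⟩ := next.surjective x
      rcases Nat.eq_zero_or_pos n with rfl | hn
      · rw [iterate_zero_apply] at h
        rw [he h]
      · have hlen : len w + 1 ≤ n := by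
          by_contra hlt
          have := hfirst w (n - 1) (by omega)
          rw [Nat.sub_add_cancel hn, h] at this
          exact hes y this
        have h' : φ^[n - (len w + 1)] (e w) = e y := by
          rw [← h, ← hret w, ← iterate_add_apply, Nat.sub_add_cancel hlen]
        have hw : next.SameCycle w (next w) := ⟨1, rfl⟩
        exact hw.symm.trans (ih _ (by omega) w y h')
  rw [numOrbits, numOrbits, numOrbits, ← Nat.card_sum]
  symm
  refine Nat.card_congr (Equiv.ofBijective
    (Sum.elim (Quotient.map' e hnext) (Quotient.map' Subtype.val hpart)) ⟨?_, ?_⟩)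
  · rintro (x | x) (y | y) h <;> obtain ⟨x, rfl⟩ := Quotient.exists_rep x <;>
      obtain ⟨y, rfl⟩ := Quotient.exists_rep y
    · obtain ⟨n, hn⟩ := SameCycle.exists_nat_pow_eq (Quotient.exact h : φ.SameCycle (e x) (e y))
      rw [← iterate_eq_pow] at hn
      exact congrArg Sum.inl (Quotient.sound (hback n x y hn))
    · exact absurd (y.2 _ (Quotient.exact h : φ.SameCycle (e x) y.1).symm) (hes x)
    · exact absurd (x.2 _ (Quotient.exact h : φ.SameCycle x.1 (e y))) (hes y)
    · have hxy : (cyclicPartPerm φ s).SameCycle x y :=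
        sameCycle_subtypePerm.2 (Quotient.exact h : φ.SameCycle x.1 y.1)
      exact congrArg Sum.inr (Quotient.sound hxy)
  · rintro ⟨d⟩
    by_cases hd : ∀ e, φ.SameCycle d e → e ∈ s
    · exact ⟨Sum.inr (Quotient.mk _ ⟨d, hd⟩), rfl⟩
    · push Not at hd
      obtain ⟨d', hdd', hd'⟩ := hd
      obtain ⟨x, rfl⟩ := hse d' hd'
      exact ⟨Sum.inl (Quotient.mk _ x), Quotient.sound hdd'.symm⟩

/-- Cyclic lists for a relation which is the restriction of a permutation correspond to the points
of the cycles along which the relation is everywhere defined. -/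
theorem natCard_cyclic_lists {A : Type*} [Finite D] {φ : Perm D} {s : A → D}
    (hs : Function.Injective s) {rel : A → A → Prop}
    (hrel : ∀ a b, φ (s a) = s b ↔ rel b a) (m : ℕ) :
    Nat.card {l : List A // (l ≠ [] ∧ l.Nodup ∧ l.IsChain (fun a b => rel b a) ∧
      ∃ h hl, l.head? = some h ∧ l.getLast? = some hl ∧ rel h hl) ∧ l.length = m} =
    Nat.card {z : CyclicPart φ (Set.range s) // minimalPeriod φ z.1 = m} := by
  have hget : ∀ l : List A, (hne : l ≠ []) → l.IsChain (fun a b => rel b a) →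
      ∀ k (hk : k < l.length), s l[k] = φ^[k] (s (l.head hne)) := by
    intro l hne hl k
    induction k with
    | zero => intro hk; rw [List.head_eq_getElem, iterate_zero_apply]
    | succ k ih =>
      intro hk
      rw [iterate_succ_apply', ← ih (by omega), (hrel _ _).2 (List.isChain_iff_getElem.1 hl k hk)]
  have hper : ∀ l : List A, (hne : l ≠ []) → l.Nodup → l.IsChain (fun a b => rel b a) →
      (∃ h hl, l.head? = some h ∧ l.getLast? = some hl ∧ rel h hl) →
      minimalPeriod φ (s (l.head hne)) = l.length := by
    rintro l hne hnd hl ⟨h, hl', hh, hlast, hr⟩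
    have hlen := List.length_pos_of_ne_nil hne
    obtain rfl : l.head hne = h := by
      rw [List.head?_eq_some_head hne] at hh
      exact Option.some.inj hh
    obtain rfl : l.getLast hne = hl' := by
      rw [List.getLast?_eq_some_getLast hne] at hlast
      exact Option.some.inj hlast
    have hp : IsPeriodicPt φ l.length (s (l.head hne)) := by
      have h1 := hget l hne hl (l.length - 1) (by omega)
      rw [← List.getLast_eq_getElem hne] at h1
      rw [← hrel, h1, ← iterate_succ_apply' (f := φ), Nat.succ_eq_add_one,
        Nat.sub_add_cancel hlen] at hr
      exact hr
    refine le_antisymm (hp.minimalPeriod_le hlen) ?_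
    by_contra! hlt
    have h0 := hget l hne hl 0 hlen
    have h1 := hget l hne hl _ hlt
    rw [iterate_minimalPeriod] at h1
    rw [iterate_zero_apply] at h0
    have h2 := hnd.getElem_inj_iff.1 (hs (h1.trans h0.symm))
    exact (hp.minimalPeriod_pos hlen).ne' h2
  refine Nat.card_congr (Equiv.ofBijective (fun l => ⟨⟨s (l.1.head l.2.1.1), ?_⟩, ?_⟩) ⟨?_, ?_⟩)
  · obtain ⟨l, ⟨hne, hnd, hl, hc⟩, -⟩ := l
    intro e he
    obtain ⟨n, rfl⟩ := he.exists_nat_pow_eq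
    have hlen := List.length_pos_of_ne_nil hne
    rw [← iterate_eq_pow, ← iterate_mod_minimalPeriod_eq, hper l hne hnd hl hc,
      ← hget l hne hl _ (Nat.mod_lt _ hlen)]
    exact Set.mem_range_self _
  · obtain ⟨l, ⟨hne, hnd, hl, hc⟩, hm⟩ := l
    exact (hper l hne hnd hl hc).trans hm
  · rintro ⟨l, ⟨hne, hnd, hl, hc⟩, hm⟩ ⟨l', ⟨hne', hnd', hl', hc'⟩, hm'⟩ h
    have h : s (l.head hne) = s (l'.head hne') := congrArg (fun z => z.1.1) h
    refine Subtype.ext (List.ext_getElem (hm.trans hm'.symm) fun k hk hk' => hs ?_)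
    rw [hget l hne hl, hget l' hne' hl', h]
  · rintro ⟨⟨d, hd⟩, hm⟩
    have hm : minimalPeriod φ d = m := hm
    have hpos : 0 < m := hm ▸
      minimalPeriod_pos_of_mem_periodicPts (φ.injective.mem_periodicPts d)
    choose g hg using fun k : ℕ => hd (φ^[k] d) ⟨k, by rw [iterate_eq_pow, zpow_natCast]⟩
    have hstep : ∀ k, rel (g (k + 1)) (g k) := fun k => by
      rw [← hrel, hg, hg, iterate_succ_apply']
    have hne : (List.range m).map g ≠ [] := by
      simp only [ne_eq, List.map_eq_nil_iff, List.range_eq_nil]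
      omega
    have hhead : ((List.range m).map g).head hne = g 0 := by
      simp [List.head_eq_getElem]
    refine ⟨⟨(List.range m).map g, ⟨hne, ?_, ?_, g 0, g (m - 1), ?_, ?_, ?_⟩, by simp⟩, ?_⟩
    · refine List.Nodup.map_on (fun i hi j hj h => ?_) List.nodup_range
      refine iterate_injOn_Iio_minimalPeriod (f := φ) (x := d)
        (hm ▸ List.mem_range.1 hi) (hm ▸ List.mem_range.1 hj) ?_
      change φ^[i] d = φ^[j] d
      rw [← hg, ← hg, h]
    · rw [List.isChain_iff_getElem]
      intro i hi
      simpa using hstep i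
    · rw [List.head?_eq_some_head hne, hhead]
    · rw [List.getLast?_eq_some_getLast hne]
      simp [List.getLast_eq_getElem]
    · rw [← hrel, hg, hg, ← iterate_succ_apply' (f := φ), Nat.succ_eq_add_one,
        Nat.sub_add_cancel hpos, ← hm, iterate_minimalPeriod, iterate_zero_apply]
    · refine Subtype.ext (Subtype.ext ?_)
      change s (((List.range m).map g).head hne) = d
      rw [hhead, hg, iterate_zero_apply]

end Equiv.Perm

theorem FinQuiver.nA_eq_of_numCycles_eq_two {Q : FinQuiver} (h : Q.numCycles = 2) :
    Q.nA = Q.nV + 1 := by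
  have hne : {n | ∃ R : Finset (Fin Q.nA), R.card = n ∧ Q.IsSpanningTreeOn Rᶜ}.Nonempty :=
    Nat.nonempty_of_pos_sInf (by
      change 0 < Q.numCycles
      omega)
  obtain ⟨R, hR, -, hcard⟩ := Nat.sInf_mem hne
  change R.card = Q.numCycles at hR
  have := R.card_add_card_compl
  rw [Fintype.card_fin] at this
  omega

theorem FinQuiver.Connected.exists_arrow_at {Q : FinQuiver} (hconn : Q.Connected) (hA : 0 < Q.nA)
    (v : Fin Q.nV) : (∃ a, Q.src a = v) ∨ ∃ a, Q.tgt a = v := by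
  rcases Relation.ReflTransGen.cases_head (hconn.2 v (Q.src ⟨0, hA⟩)) with
    h | ⟨_, ⟨a, -, h | h⟩, -⟩
  · exact Or.inl ⟨_, h.symm⟩
  · exact Or.inl ⟨a, h.1⟩
  · exact Or.inr ⟨a, h.2⟩

theorem eq_of_natCard_subtype_le_one {α : Type*} [Finite α] {p : α → Prop}
    (h : Nat.card {a // p a} ≤ 1) {a b : α} (ha : p a) (hb : p b) : a = b := by
  have := Finite.card_le_one_iff_subsingleton.1 h
  exact congrArg Subtype.val (Subsingleton.elim (⟨a, ha⟩ : {a // p a}) ⟨b, hb⟩)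

/-- The involution of the darts `(v, ±)` exchanging the two darts at every vertex. -/
def dartFlip (V : Type*) : Equiv.Perm (V × Bool) := Equiv.prodCongr (Equiv.refl V) Equiv.boolNot

theorem dartFlip_apply {V : Type*} (v : V) (b : Bool) : dartFlip V (v, b) = (v, !b) := rfl

theorem numOrbits_dartFlip (V : Type*) : (dartFlip V).numOrbits = Nat.card V := by
  have hfst : Equiv.Perm.SameCycle.setoid (dartFlip V) ≤ Setoid.ker Prod.fst :=
    Equiv.Perm.sameCycle_setoid_le fun d => rfl
  refine Nat.card_congr (Equiv.ofBijective (Quotient.lift Prod.fst hfst) ⟨?_, fun v => ?_⟩)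
  · intro x y h
    obtain ⟨⟨v, b⟩, rfl⟩ := Quotient.exists_rep x
    obtain ⟨⟨w, c⟩, rfl⟩ := Quotient.exists_rep y
    obtain rfl : v = w := h
    rcases eq_or_ne c b with rfl | hcb
    · rfl
    · have hsc : (dartFlip V).SameCycle (v, b) (v, c) :=
        ⟨1, by rw [zpow_one, dartFlip_apply, Bool.eq_not_of_ne hcb]⟩
      exact Quotient.sound hsc
  · exact ⟨Quotient.mk _ (v, true), rfl⟩

namespace GentleAlg

variable {A : GentleAlg}

/-- The path `b ∘ a` is defined and nonzero. -/
def PermStep (A : GentleAlg) (a b : Fin A.nA) : Prop := A.tgt a = A.src b ∧ ¬ A.rel b a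

theorem not_transGen_permStep_self (a : Fin A.nA) : ¬ Relation.TransGen A.PermStep a a := by
  intro h
  obtain ⟨c, hac, hca⟩ := Relation.TransGen.tail'_iff.1 h
  obtain ⟨l, hl, hlast⟩ := List.exists_isChain_cons_of_relationReflTransGen hac
  refine hca.2 (A.no_perm_cycle (a :: l) (List.cons_ne_nil _ _) hl a c rfl ?_ hca.1)
  rw [List.getLast?_eq_some_getLast (List.cons_ne_nil _ _), hlast]

theorem wellFounded_permStep : WellFounded A.PermStep := by
  have : Std.Irrefl (Relation.TransGen A.PermStep) := ⟨not_transGen_permStep_self⟩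
  exact Subrelation.wf Relation.TransGen.single
    (Finite.wellFounded_of_trans_of_irrefl (Relation.TransGen A.PermStep))

theorem isPermPath_cons {a : Fin A.nA} {l : List (Fin A.nA)} (hl : A.IsPermPath l) (hne : l ≠ []) :
    A.IsPermPath (a :: l) ↔ A.PermStep a (l.head hne) := by
  have hl : l.IsChain A.PermStep := hl
  change (a :: l).IsChain A.PermStep ↔ _
  simp [List.isChain_cons, hl, List.head?_eq_some_head hne]

theorem isPermPath_append {a : Fin A.nA} {l : List (Fin A.nA)} (hl : A.IsPermPath l)
    (hne : l ≠ []) : A.IsPermPath (l ++ [a]) ↔ A.PermStep (l.getLast hne) a := by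
  have hl : l.IsChain A.PermStep := hl
  change (l ++ [a]).IsChain A.PermStep ↔ _
  simp [List.isChain_append, hl, List.getLast?_eq_some_getLast hne]

theorem exists_permPath_getLast (a : Fin A.nA) :
    ∃ (l : List (Fin A.nA)) (hne : l ≠ []), A.IsPermPath l ∧ (∀ b, ¬ A.PermStep b (l.head hne)) ∧
      l.getLast hne = a := by
  induction a using wellFounded_permStep.induction with
  | _ a ih =>
    by_cases h : ∃ b, A.PermStep b a
    · obtain ⟨b, hb⟩ := h
      obtain ⟨l, hne, hl, hhead, rfl⟩ := ih b hb
      refine ⟨l ++ [a], by simp, (isPermPath_append hl hne).2 hb, ?_, by simp⟩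
      rwa [List.head_append_of_ne_nil hne]
    · push Not at h
      exact ⟨[a], by simp, List.isChain_singleton a, h, rfl⟩

theorem exists_permThread_getLast {a : Fin A.nA} (h : ∀ b, ¬ A.PermStep a b) :
    ∃ (l : List (Fin A.nA)) (hl : A.IsNontrivPermThread l), l.getLast hl.1 = a := by
  obtain ⟨l, hne, hl, hhead, rfl⟩ := exists_permPath_getLast a
  exact ⟨l, ⟨hne, hl, fun b hb => hhead b ((isPermPath_cons hl hne).1 hb),
    fun b hb => h b ((isPermPath_append hl hne).1 hb)⟩, rfl⟩

theorem eq_of_getLast?_eq {l l' : List (Fin A.nA)} (hl : A.IsPermPath l) (hl' : A.IsPermPath l')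
    (hh : ∀ b, ∀ a ∈ l.head?, ¬ A.PermStep b a) (hh' : ∀ b, ∀ a ∈ l'.head?, ¬ A.PermStep b a)
    (h : l.getLast? = l'.getLast?) : l = l' := by
  induction l using List.reverseRecOn generalizing l' with
  | nil =>
    rw [List.getLast?_nil, eq_comm, List.getLast?_eq_none_iff] at h
    exact h.symm
  | append_singleton l a ih =>
    rcases List.eq_nil_or_concat' l' with rfl | ⟨l', a', rfl⟩
    · simp at h
    obtain rfl : a = a' := by simpa using h
    obtain ⟨hl, -, hla⟩ := List.isChain_append.1 hl
    obtain ⟨hl', -, hla'⟩ := List.isChain_append.1 hl'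
    rw [ih hl hl' ?_ ?_ ?_]
    · intro b c hc
      exact hh b c (by rw [List.head?_append, hc]; rfl)
    · intro b c hc
      exact hh' b c (by rw [List.head?_append, hc]; rfl)
    · cases hb : l.getLast? with
      | none =>
        cases hb' : l'.getLast? with
        | none => rfl
        | some b' =>
          rw [List.getLast?_eq_none_iff] at hb
          subst hb
          exact absurd (hla' b' hb' a rfl) (hh b' a rfl)
      | some b =>
        cases hb' : l'.getLast? with
        | none =>
          rw [List.getLast?_eq_none_iff] at hb'
          subst hb'
          exact absurd (hla b hb a rfl) (hh' b a rfl)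
        | some b' =>
          have h1 := hla b hb a rfl
          have h2 := hla' b' hb' a rfl
          rw [A.perm_pred_unique a b b' h1.1.symm h1.2 h2.1.symm h2.2]

theorem IsNontrivPermThread.not_permStep_head {l : List (Fin A.nA)}
    (hl : A.IsNontrivPermThread l) (a : Fin A.nA) : ¬ A.PermStep a (l.head hl.1) :=
  fun h => hl.2.2.1 a ((isPermPath_cons hl.2.1 hl.1).2 h)

theorem IsNontrivPermThread.not_permStep_getLast {l : List (Fin A.nA)}
    (hl : A.IsNontrivPermThread l) (a : Fin A.nA) : ¬ A.PermStep (l.getLast hl.1) a :=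
  fun h => hl.2.2.2 a ((isPermPath_append hl.2.1 hl.1).2 h)

theorem IsNontrivPermThread.eq_of_getLast_eq {l l' : List (Fin A.nA)}
    (hl : A.IsNontrivPermThread l) (hl' : A.IsNontrivPermThread l')
    (h : l.getLast hl.1 = l'.getLast hl'.1) : l = l' := by
  refine eq_of_getLast?_eq hl.2.1 hl'.2.1 (fun b a ha => ?_) (fun b a ha => ?_) ?_
  · rw [List.head?_eq_some_head hl.1] at ha
    exact Option.some.inj ha ▸ hl.not_permStep_head b
  · rw [List.head?_eq_some_head hl'.1] at ha
    exact Option.some.inj ha ▸ hl'.not_permStep_head b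
  · rw [List.getLast?_eq_some_getLast hl.1, List.getLast?_eq_some_getLast hl'.1, h]

namespace Signs

variable (S : A.Signs)

/-- The dart at which an arrow starts. -/
def srcDart (a : Fin A.nA) : Fin A.nV × Bool := (A.src a, S.sgn a)

/-- The dart at which an arrow ends, normalised such that it is the starting dart of the next arrow
of a permitted path. -/
def tgtDart (a : Fin A.nA) : Fin A.nV × Bool := (A.tgt a, !S.esgn a)

theorem srcDart_injective : Function.Injective S.srcDart := by
  intro a b h
  by_contra hab
  exact S.sgn_src a b hab (congrArg Prod.fst h) (congrArg Prod.snd h)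

theorem tgtDart_injective : Function.Injective S.tgtDart := by
  intro a b h
  by_contra hab
  exact S.esgn_tgt a b hab (congrArg Prod.fst h) (Bool.not_inj (congrArg Prod.snd h))

theorem tgtDart_eq_of_permStep {a b : Fin A.nA} (h : A.PermStep a b) :
    S.tgtDart a = S.srcDart b :=
  Prod.ext h.1 (S.sgn_comp a b h.1.symm h.2).symm

/-- The dart at which a permitted thread starts. -/
noncomputable def startDart (H : A.PermThread) : Fin A.nV × Bool := (A.pStart H, S.pSgn H)

/-- The dart at which a permitted thread ends. -/
noncomputable def endDart (H : A.PermThread) : Fin A.nV × Bool := (A.pEnd H, !S.pEps H)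

theorem startDart_inr (v : {v : Fin A.nV // A.HasTrivPermThread v}) :
    S.startDart (.inr v) = (v.1, S.pTrivSgn v.1) := rfl

theorem endDart_inr (v : {v : Fin A.nV // A.HasTrivPermThread v}) :
    S.endDart (.inr v) = (v.1, S.pTrivSgn v.1) :=
  Prod.ext rfl (Bool.not_not _)

theorem pTrivSgn_eq_not_sgn {v : Fin A.nV} (hv : A.HasTrivPermThread v) {c : Fin A.nA}
    (hc : A.src c = v) : S.pTrivSgn v = !S.sgn c := by
  have h : ∃ c, A.src c = v := ⟨c, hc⟩
  rw [pTrivSgn, dif_pos h, eq_of_natCard_subtype_le_one hv.1 h.choose_spec hc]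

theorem fTrivSgn_eq_not_sgn {v : Fin A.nV} (hv : A.HasTrivForbThread v) {c : Fin A.nA}
    (hc : A.src c = v) : S.fTrivSgn v = !S.sgn c := by
  have h : ∃ c, A.src c = v := ⟨c, hc⟩
  rw [fTrivSgn, dif_pos h, eq_of_natCard_subtype_le_one hv.1 h.choose_spec hc]

theorem pTrivSgn_eq_esgn {v : Fin A.nV} (hv : A.HasTrivPermThread v) {b : Fin A.nA}
    (hb : A.tgt b = v) : S.pTrivSgn v = S.esgn b := by
  by_cases h : ∃ c, A.src c = v
  · obtain ⟨c, hc⟩ := h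
    rw [S.pTrivSgn_eq_not_sgn hv hc, S.sgn_comp b c (hc.trans hb.symm) (hv.2.2 b c hb hc),
      Bool.not_not]
  · have h2 : ∃ b, A.tgt b = v := ⟨b, hb⟩
    rw [pTrivSgn, dif_neg h, dif_pos h2, eq_of_natCard_subtype_le_one hv.2.1 h2.choose_spec hb]

theorem startDart_ne_tgtDart (H : A.PermThread) (a : Fin A.nA)
    (hsep : ∀ a b, S.srcDart b = S.tgtDart a → A.PermStep a b) : S.startDart H ≠ S.tgtDart a := by
  intro h
  rcases H with l | v
  · exact l.2.not_permStep_head a (hsep _ _ h)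
  · have hsgn : S.pTrivSgn v.1 = !S.esgn a := congrArg Prod.snd h
    rw [S.pTrivSgn_eq_esgn v.2 (congrArg Prod.fst h).symm] at hsgn
    exact Bool.not_ne_self _ hsgn.symm

theorem endDart_ne_srcDart (H : A.PermThread) (a : Fin A.nA)
    (hsep : ∀ a b, S.srcDart b = S.tgtDart a → A.PermStep a b) : S.endDart H ≠ S.srcDart a := by
  intro h
  rcases H with l | v
  · exact l.2.not_permStep_getLast a (hsep _ _ h.symm)
  · rw [S.endDart_inr] at h
    have hsgn : S.pTrivSgn v.1 = S.sgn a := congrArg Prod.snd h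
    rw [S.pTrivSgn_eq_not_sgn v.2 (congrArg Prod.fst h).symm] at hsgn
    exact Bool.not_ne_self _ hsgn

theorem endDart_injective (hsep : ∀ a b, S.srcDart b = S.tgtDart a → A.PermStep a b) :
    Function.Injective S.endDart := by
  rintro (l | v) (l' | w) h
  · exact congrArg Sum.inl (Subtype.ext (l.2.eq_of_getLast_eq l'.2 (S.tgtDart_injective h)))
  · rw [S.endDart_inr, ← S.startDart_inr] at h
    exact absurd h.symm (S.startDart_ne_tgtDart (.inr w) _ hsep)
  · rw [S.endDart_inr, ← S.startDart_inr] at h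
    exact absurd h (S.startDart_ne_tgtDart (.inr v) _ hsep)
  · exact congrArg Sum.inr (Subtype.ext (congrArg Prod.fst h))

theorem reflTransGen_startDart_endDart (H : A.PermThread) :
    Relation.ReflTransGen (fun x y => ∃ a, S.srcDart a = x ∧ S.tgtDart a = y)
      (S.startDart H) (S.endDart H) := by
  have key : ∀ (l : List (Fin A.nA)) (a : Fin A.nA), (a :: l).IsChain A.PermStep →
      Relation.ReflTransGen (fun x y => ∃ a, S.srcDart a = x ∧ S.tgtDart a = y)
        (S.srcDart a) (S.tgtDart ((a :: l).getLast (List.cons_ne_nil _ _))) := by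
    intro l
    induction l with
    | nil => exact fun a _ => .single ⟨a, rfl, rfl⟩
    | cons b l ih =>
      intro a h
      rw [List.isChain_cons_cons] at h
      refine .head ⟨a, rfl, S.tgtDart_eq_of_permStep h.1⟩ ?_
      rw [List.getLast_cons (List.cons_ne_nil _ _)]
      exact ih b h.2
  rcases H with ⟨_ | ⟨a, l⟩, hl⟩ | v
  · exact absurd rfl hl.1
  · exact key l a hl.2.1
  · rw [S.startDart_inr, S.endDart_inr]

theorem exists_endDart_eq (hconn : A.toFinQuiver.Connected) (hA : 0 < A.nA)
    (hrel : ∀ a b, A.rel b a → S.srcDart b = dartFlip _ (S.tgtDart a))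
    (d : Fin A.nV × Bool) (hd : d ∉ Set.range S.srcDart) : ∃ H, S.endDart H = d := by
  by_cases hd' : d ∈ Set.range S.tgtDart
  · obtain ⟨a, rfl⟩ := hd'
    obtain ⟨l, hl, rfl⟩ := exists_permThread_getLast
      fun b hb => hd ⟨b, (S.tgtDart_eq_of_permStep (a := a) hb).symm⟩
    exact ⟨.inl ⟨l, hl⟩, rfl⟩
  obtain ⟨v, σ⟩ := d
  have hsrc : ∀ c, A.src c = v → S.sgn c = !σ := fun c hc =>
    Bool.eq_not_of_ne fun h => hd ⟨c, Prod.ext hc h⟩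
  have htgt : ∀ b, A.tgt b = v → S.esgn b = σ := fun b hb => by
    by_contra h
    exact hd' ⟨b, Prod.ext hb ((congrArg not (Bool.eq_not_of_ne h)).trans (Bool.not_not _))⟩
  have hv : A.HasTrivPermThread v := by
    refine ⟨?_, ?_, fun b c hb hc h => ?_⟩
    · rw [Finite.card_le_one_iff_subsingleton]
      exact ⟨fun a b => Subtype.ext (S.srcDart_injective
        (Prod.ext (a.2.trans b.2.symm) ((hsrc _ a.2).trans (hsrc _ b.2).symm)))⟩
    · rw [Finite.card_le_one_iff_subsingleton]
      exact ⟨fun a b => Subtype.ext (S.tgtDart_injective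
        (Prod.ext (a.2.trans b.2.symm) (congrArg not ((htgt _ a.2).trans (htgt _ b.2).symm))))⟩
    · have : S.sgn c = !!S.esgn b := congrArg Prod.snd (hrel b c h)
      rw [hsrc c hc, htgt b hb, Bool.not_not] at this
      exact Bool.not_ne_self _ this
  refine ⟨.inr ⟨v, hv⟩, ?_⟩
  rw [S.endDart_inr]
  refine Prod.ext rfl ?_
  rcases hconn.exists_arrow_at hA v with ⟨c, hc⟩ | ⟨b, hb⟩
  · exact (S.pTrivSgn_eq_not_sgn hv hc).trans (by rw [hsrc c hc]; exact Bool.not_not _)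
  · exact (S.pTrivSgn_eq_esgn hv hb).trans (htgt b hb)

end Signs

end GentleAlg

theorem Relation.ReflTransGen.eq_of_leftUnique {α : Type*} {r : α → α → Prop}
    (hr : Relator.LeftUnique r) {x y z : α} (hx : ∀ w, ¬ r w x) (hy : ∀ w, ¬ r w y)
    (hxz : Relation.ReflTransGen r x z) (hyz : Relation.ReflTransGen r y z) : x = y := by
  rcases Relation.ReflTransGen.total_of_right_unique (r := Function.swap r)
    (fun a b c h h' => hr h h') hxz.swap hyz.swap with h | h
  · rcases Relation.ReflTransGen.cases_head h with h | ⟨w, hw, -⟩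
    · exact h
    · exact absurd hw (hx w)
  · rcases Relation.ReflTransGen.cases_head h with h | ⟨w, hw, -⟩
    · exact h.symm
    · exact absurd hw (hy w)

namespace GentleAlg

variable {A : GentleAlg}

namespace Signs

variable (S : A.Signs)

/-- The dart at which a forbidden thread starts. -/
noncomputable def forbStartDart (F : A.ForbThread) : Fin A.nV × Bool := (A.fStart F, S.fSgn F)

/-- The dart at which a forbidden thread ends. -/
noncomputable def forbEndDart (F : A.ForbThread) : Fin A.nV × Bool := (A.fEnd F, S.fEps F)

theorem iterate_forbStartDart {φ : Equiv.Perm (Fin A.nV × Bool)}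
    (hφ : ∀ a, φ (S.srcDart a) = dartFlip _ (S.tgtDart a))
    (hrel : ∀ a b, A.rel b a → S.srcDart b = dartFlip _ (S.tgtDart a)) (F : A.ForbThread) :
    φ^[A.forbLen F] (S.forbStartDart F) = S.forbEndDart F ∧
      ∀ k < A.forbLen F, φ^[k] (S.forbStartDart F) ∈ Set.range S.srcDart := by
  rcases F with ⟨l, hl⟩ | v
  · have hlen : 0 < l.length := List.length_pos_of_ne_nil hl.1
    have hget : ∀ k (hk : k < l.length), φ^[k] (S.srcDart (l.head hl.1)) = S.srcDart l[k] := by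
      intro k
      induction k with
      | zero => intro hk; rw [List.head_eq_getElem, iterate_zero_apply]
      | succ k ih =>
        intro hk
        rw [iterate_succ_apply', ih (by omega), hφ,
          hrel _ _ (List.isChain_iff_getElem.1 hl.2.1.2 k hk)]
    refine ⟨?_, fun k hk => ⟨_, (hget k hk).symm⟩⟩
    change φ^[l.length] (S.srcDart (l.head hl.1)) = _
    rw [← Nat.sub_add_cancel hlen, Nat.add_one, iterate_succ_apply', hget _ (by omega), hφ,
      ← List.getLast_eq_getElem hl.1]
    exact Prod.ext rfl (Bool.not_not _)
  · exact ⟨rfl, fun k hk => absurd hk (Nat.not_lt_zero k)⟩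

end Signs

namespace AGPairing

variable {S : A.Signs} (P : A.AGPairing S)

theorem endDart_eq (H : A.PermThread) : S.endDart H = S.forbEndDart (P.forb H) :=
  Prod.ext (P.end_forb H).symm (P.eps_forb H).symm

theorem forbStartDart_eq (H : A.PermThread) :
    S.forbStartDart (P.forb H) = dartFlip _ (S.startDart (P.next H)) :=
  Prod.ext (P.start_next H).symm (by
    change S.fSgn (P.forb H) = !S.pSgn (P.next H)
    rw [P.sgn_next, Bool.not_not])

theorem not_rel_of_srcDart_eq (P : A.AGPairing S) {a b : Fin A.nA}
    (h : S.srcDart b = S.tgtDart a) : ¬ A.rel b a := by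
  intro hrel
  have hsrc : A.src b = A.tgt a := congrArg Prod.fst h
  have hsgn : S.sgn b = !S.esgn a := congrArg Prod.snd h
  have htgt : ∀ a', A.tgt a' = A.tgt a → a' = a := by
    intro a' ha'
    by_contra hne
    refine S.esgn_tgt a' a hne ha' (Bool.not_inj ?_)
    rw [← hsgn, S.sgn_comp a' b (hsrc.trans ha'.symm)
      fun h' => hne (A.rel_pred_unique b a' a h' hrel)]
  have hout : ∀ b', A.src b' = A.tgt a → b' = b := by
    intro b' hb'
    by_contra hne
    refine S.sgn_src b' b hne (hb'.trans hsrc.symm) ?_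
    rw [hsgn, S.sgn_comp a b' hb' fun h' => hne (A.rel_succ_unique a b' b h' hrel)]
  obtain ⟨l, hl, hlast⟩ := exists_permThread_getLast (a := a) fun c hc => by
    obtain rfl := hout c hc.1.symm
    exact hc.2 hrel
  have hend := P.endDart_eq (.inl ⟨l, hl⟩)
  have hfst : A.tgt (l.getLast hl.1) = A.fEnd (P.forb (.inl ⟨l, hl⟩)) := congrArg Prod.fst hend
  have hsnd : (!S.esgn (l.getLast hl.1)) = S.fEps (P.forb (.inl ⟨l, hl⟩)) :=
    congrArg Prod.snd hend
  rw [hlast] at hfst hsnd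
  generalize P.forb (.inl ⟨l, hl⟩) = F at hfst hsnd
  rcases F with l' | v
  · have hsnd : (!S.esgn a) = S.esgn (l'.1.getLast l'.2.1) := hsnd
    rw [htgt _ hfst.symm] at hsnd
    exact Bool.not_ne_self _ hsnd
  · have hsnd : (!S.esgn a) = S.fTrivSgn v.1 := hsnd
    rw [S.fTrivSgn_eq_not_sgn v.2 (hsrc.trans hfst), hsgn, Bool.not_not] at hsnd
    exact Bool.not_ne_self _ hsnd

theorem permStep_iff (P : A.AGPairing S) {a b : Fin A.nA} :
    A.PermStep a b ↔ S.tgtDart a = S.srcDart b :=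
  ⟨S.tgtDart_eq_of_permStep, fun h =>
    ⟨congrArg Prod.fst h, P.not_rel_of_srcDart_eq h.symm⟩⟩

theorem rel_iff (P : A.AGPairing S) {a b : Fin A.nA} :
    A.rel b a ↔ S.srcDart b = dartFlip _ (S.tgtDart a) := by
  constructor
  · intro h
    have hsrc := A.rel_comp b a h
    refine Prod.ext hsrc (Bool.eq_not_of_ne fun h' => ?_)
    exact P.not_rel_of_srcDart_eq (Prod.ext hsrc h') h
  · intro h
    by_contra hrel
    have hsrc : A.src b = A.tgt a := congrArg Prod.fst h
    have := congrArg Prod.snd h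
    exact Bool.not_ne_self _ (this.symm.trans (S.sgn_comp a b hsrc hrel))

/-- The total number of arrows of the forbidden threads met in `n` steps of the algorithm. -/
def totalForbLen (n : ℕ) (H : A.PermThread) : ℕ :=
  ∑ k ∈ Finset.range n, A.forbLen (P.forb (P.next^[k] H))

/-- The pair recorded by the algorithm started at a permitted thread. -/
noncomputable def agPair (H : A.PermThread) : ℕ × ℕ :=
  (minimalPeriod P.next H, P.totalForbLen (minimalPeriod P.next H) H)

theorem agPair_next [Finite A.PermThread] (H : A.PermThread) :
    P.agPair (P.next H) = P.agPair H := by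
  have hper : H ∈ periodicPts P.next := P.next_bij.injective.mem_periodicPts H
  rw [agPair, minimalPeriod_apply hper, agPair]
  refine Prod.ext rfl (Nat.add_right_cancel (m := A.forbLen (P.forb H)) ?_)
  have h1 := Finset.sum_range_succ (fun k => A.forbLen (P.forb (P.next^[k] H)))
    (minimalPeriod P.next H)
  have h2 := Finset.sum_range_succ' (fun k => A.forbLen (P.forb (P.next^[k] H)))
    (minimalPeriod P.next H)
  rw [iterate_minimalPeriod] at h1
  exact h2.symm.trans h1

theorem agPhi_eq_count [Finite A.PermThread] {φ : Equiv.Perm (Fin A.nV × Bool)}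
    (hφ : ∀ a b, φ (S.srcDart a) = S.srcDart b ↔ A.rel b a) (n m : ℕ) :
    GentleAlg.agPhi P n m = Multiset.count (n, m)
      (Equiv.Perm.orbitValues (Equiv.ofBijective P.next P.next_bij) P.agPair +
        Equiv.Perm.orbitValues (Equiv.Perm.cyclicPartPerm φ (Set.range S.srcDart))
          fun z => (0, minimalPeriod φ z.1)) := by
  rw [Multiset.count_add, agPhi]
  split_ifs with hn
  · subst hn
    rw [Multiset.count_eq_zero_of_notMem, Nat.zero_add]
    · have h1 := Equiv.Perm.natCard_cyclic_lists S.srcDart_injective hφ m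
      have h2 := Equiv.Perm.natCard_fiber_eq_mul_count
        (Equiv.Perm.cyclicPartPerm φ (Set.range S.srcDart))
        (fun z => (0, minimalPeriod φ z.1))
        (fun z => Prod.ext rfl (minimalPeriod_apply (φ.injective.mem_periodicPts z.1)))
        (0, m) m fun z hz => by
          rw [Equiv.Perm.minimalPeriod_cyclicPartPerm]
          exact congrArg Prod.snd hz
      have h3 : Nat.card {l : List (Fin A.nA) // A.IsRelCycle l ∧ l.length = m} =
          m * Multiset.count (0, m)
            (Equiv.Perm.orbitValues (Equiv.Perm.cyclicPartPerm φ (Set.range S.srcDart))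
              fun z => (0, minimalPeriod φ z.1)) := by
        refine Eq.trans ?_ h2
        refine Eq.trans ?_ (h1.trans ?_)
        · rfl
        · simp
      rw [h3]
      rcases Nat.eq_zero_or_pos m with rfl | hm
      · rw [Nat.div_zero, Multiset.count_eq_zero_of_notMem]
        intro h
        obtain ⟨z, hz⟩ := Equiv.Perm.exists_of_mem_orbitValues h
        exact (minimalPeriod_pos_of_mem_periodicPts (φ.injective.mem_periodicPts z.1)).ne'
          (congrArg Prod.snd hz)
      · rw [Nat.mul_div_cancel_left _ hm]
    · intro h
      obtain ⟨H, hH⟩ := Equiv.Perm.exists_of_mem_orbitValues h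
      exact (minimalPeriod_pos_of_mem_periodicPts (P.next_bij.injective.mem_periodicPts H)).ne'
        (congrArg Prod.fst hH)
  · rw [Multiset.count_eq_zero_of_notMem
      (s := Equiv.Perm.orbitValues (Equiv.Perm.cyclicPartPerm _ _) _), Nat.add_zero]
    · have h1 := Equiv.Perm.natCard_fiber_eq_mul_count (Equiv.ofBijective P.next P.next_bij)
        P.agPair P.agPair_next (n, m) n fun H hH => congrArg Prod.fst hH
      rw [← Nat.mul_div_cancel_left (Multiset.count (n, m) _) (Nat.pos_of_ne_zero hn), ← h1]
      refine congrArg (· / n) (Nat.card_congr (Equiv.subtypeEquivRight fun H => ?_))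
      rw [agPair, Prod.mk.injEq]
      refine and_congr_right fun h => ?_
      rw [h, totalForbLen]
    · intro h
      obtain ⟨z, hz⟩ := Equiv.Perm.exists_of_mem_orbitValues h
      exact hn (congrArg Prod.fst hz).symm

end AGPairing

theorem natCard_quotient_le_one (hconn : A.toFinQuiver.Connected) {S : A.Signs}
    {r : Setoid (Fin A.nV × Bool)} (hflip : Equiv.Perm.SameCycle.setoid (dartFlip _) ≤ r)
    (har : ∀ a, r (S.srcDart a) (S.tgtDart a)) : Nat.card (Quotient r) ≤ 1 := by
  have hvert : ∀ v b c, r (v, b) (v, c) := by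
    intro v b c
    rcases eq_or_ne c b with rfl | h
    · exact r.refl' _
    · rw [Bool.eq_not_of_ne h]
      exact hflip ⟨1, rfl⟩
  have harr : ∀ a, r (A.src a, true) (A.tgt a, true) := fun a =>
    r.trans' (hvert _ _ _) (r.trans' (har a) (hvert _ _ _))
  have hpath : ∀ v w, r (v, true) (w, true) := by
    intro v w
    induction hconn.2 v w with
    | refl => exact r.refl' _
    | tail _ h ih =>
      obtain ⟨a, -, ⟨rfl, rfl⟩ | ⟨rfl, rfl⟩⟩ := h
      · exact r.trans' ih (harr a)
      · exact r.trans' ih (r.symm' (harr a))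
  rw [Finite.card_le_one_iff_subsingleton]
  refine ⟨fun x y => ?_⟩
  obtain ⟨⟨v, b⟩, rfl⟩ := Quotient.exists_rep x
  obtain ⟨⟨w, c⟩, rfl⟩ := Quotient.exists_rep y
  exact Quotient.sound (r.trans' (hvert v b true) (r.trans' (hpath v w) (hvert w true c)))

end GentleAlg

/-- Theorem I: for a gentle algebra with a connected two-cycle quiver,
the total multiplicity of the invariant `φ_A` is either `1` or `3`. -/
theorem card_phi_mem (A : GentleAlg) (hconn : A.toFinQuiver.Connected)
    (hc : A.toFinQuiver.numCycles = 2) (S : A.Signs) (P : GentleAlg.AGPairing A S) :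
    ∃ M : Multiset (ℕ × ℕ),
      (∀ n m, GentleAlg.agPhi P n m = Multiset.count (n, m) M) ∧
      (Multiset.card M = 1 ∨ Multiset.card M = 3) := by
  have hA : A.nA = A.nV + 1 := FinQuiver.nA_eq_of_numCycles_eq_two hc
  have hsep : ∀ a b, S.srcDart b = S.tgtDart a → A.PermStep a b :=
    fun a b h => P.permStep_iff.2 h.symm
  have hrel : ∀ a b, A.rel b a → S.srcDart b = dartFlip _ (S.tgtDart a) :=
    fun a b => P.rel_iff.1
  have hinj := S.endDart_injective hsep
  have : Finite A.PermThread := Finite.of_injective _ hinj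
  obtain ⟨σ, r, hσ, hpath, -, hflip, har, hle, hmod⟩ := Equiv.Perm.exists_closing_perm
    (dartFlip (Fin A.nV)) S.srcDart_injective S.tgtDart_injective
    (Subrelation.wf P.permStep_iff.2 GentleAlg.wellFounded_permStep) Finset.univ
  simp only [Finset.mem_univ, true_and, forall_const] at hσ hpath har
  have hend : ∀ H, S.endDart H ∉ Set.range S.srcDart := fun H ⟨a, ha⟩ =>
    S.endDart_ne_srcDart H a hsep ha.symm
  have hσend : ∀ H, σ (S.endDart H) = S.startDart H := fun H => by
    refine Relation.ReflTransGen.eq_of_leftUnique ?_ ?_ ?_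
      (hpath _ fun a ha => hend H ⟨a, ha.symm⟩) (S.reflTransGen_startDart_endDart H)
    · rintro _ _ _ ⟨a, rfl, rfl⟩ ⟨b, rfl, h⟩
      rw [S.tgtDart_injective h]
    · rintro _ ⟨a, rfl, h⟩
      rw [← hσ] at h
      exact hend H ⟨a, σ.injective h⟩
    · rintro _ ⟨a, rfl, h⟩
      exact S.startDart_ne_tgtDart H a hsep h.symm
  let φ := dartFlip (Fin A.nV) * σ
  have hφ : ∀ a, φ (S.srcDart a) = dartFlip _ (S.tgtDart a) := fun a => by
    rw [Equiv.Perm.mul_apply, hσ]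
  have hφend : ∀ H, φ (S.endDart (P.next H)) = S.forbStartDart (P.forb H) := fun H => by
    rw [Equiv.Perm.mul_apply, hσend, P.forbStartDart_eq]
  have hforb := S.iterate_forbStartDart hφ hrel
  have horb := Equiv.Perm.numOrbits_eq_add_cyclicPart (φ := φ) hinj hend
    (fun d => S.exists_endDart_eq hconn (by omega) hrel d)
    (next := Equiv.ofBijective P.next P.next_bij) (len := fun H => A.forbLen (P.forb H))
    (fun H => by
      rw [Equiv.ofBijective_apply, iterate_succ_apply, hφend, (hforb _).1, P.endDart_eq])
    fun H k hk => by
      rw [Equiv.ofBijective_apply, iterate_succ_apply, hφend]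
      exact (hforb _).2 k hk
  refine ⟨_, P.agPhi_eq_count (φ := φ) fun a b => ?_, ?_⟩
  · rw [P.rel_iff, hφ, eq_comm]
  · rw [Multiset.card_add, Equiv.Perm.card_orbitValues, Equiv.Perm.card_orbitValues, ← horb]
    have hr := GentleAlg.natCard_quotient_le_one hconn hflip har
    rw [numOrbits_dartFlip, Nat.card_fin, Finset.card_univ, Fintype.card_fin] at hle hmod
    change φ.numOrbits = 1 ∨ φ.numOrbits = 3
    change φ.numOrbits + _ ≤ _ at hle
    change (φ.numOrbits + _ + _) % 2 = 0 at hmod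
    omega
end

section
/- Let A = kQ/⟨P⟩ be a gentle algebra with two-cycle quiver Q, #Q_0 ≥ 6, and let x ∈ Q_0 be a transition vertex with incoming arrow α and outgoing arrow β (βα ∉ P). Then the invariants satisfy: φ_A is obtained from φ_{A∖{x}} by replacing exactly one pair (n,m) in the support by (n+1, m+1); in particular #φ_A = #φ_{A∖{x}}. -/
open Function CategoryTheory

namespace OrbitCount

variable {X Y : Type*}

/-- The length of the orbit of `H` together with the total weight along it. -/
noncomputable def orbitPair (σ : X → X) (w : X → ℕ) (H : X) : ℕ × ℕ :=
  (minimalPeriod σ H, ∑ k ∈ Finset.range (minimalPeriod σ H), w (σ^[k] H))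

theorem orbitPair_apply [Finite X] {σ : X → X} (hσ : Injective σ) (w : X → ℕ) (H : X) :
    orbitPair σ w (σ H) = orbitPair σ w H := by
  have hper := minimalPeriod_apply (hσ.mem_periodicPts H)
  unfold orbitPair
  rw [hper]
  refine Prod.ext rfl ?_
  obtain ⟨n, hn⟩ : ∃ n, minimalPeriod σ H = n + 1 := ⟨minimalPeriod σ H - 1, by
    have := minimalPeriod_pos_of_mem_periodicPts (hσ.mem_periodicPts H)
    omega⟩
  have hit : σ^[n + 1] H = H := by rw [← hn]; exact iterate_minimalPeriod
  simp only [hn]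
  rw [Finset.sum_range_succ, Finset.sum_range_succ' (fun k => w (σ^[k] H))]
  simp only [← iterate_succ_apply, hit, iterate_zero, id]

theorem orbitPair_iterate [Finite X] {σ : X → X} (hσ : Injective σ) (w : X → ℕ) (H : X) (k : ℕ) :
    orbitPair σ w (σ^[k] H) = orbitPair σ w H := by
  induction k with
  | zero => rfl
  | succ k ih => rw [iterate_succ_apply', orbitPair_apply hσ, ih]

theorem orbitPair_map {σ : X → X} {w : X → ℕ} {τ : Y → Y} {u : Y → ℕ} {i : X → Y}
    (hi : Injective i) {H : X} (hτ : ∀ k, τ (i (σ^[k] H)) = i (σ (σ^[k] H)))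
    (hu : ∀ k, u (i (σ^[k] H)) = w (σ^[k] H)) :
    orbitPair τ u (i H) = orbitPair σ w H := by
  have hit : ∀ k, τ^[k] (i H) = i (σ^[k] H) := fun k => by
    induction k with
    | zero => rfl
    | succ k ih => rw [iterate_succ_apply', ih, hτ, iterate_succ_apply']
  have hper : minimalPeriod τ (i H) = minimalPeriod σ H := by
    rw [minimalPeriod_eq_minimalPeriod_iff]
    intro n
    rw [IsPeriodicPt, IsFixedPt, hit, IsPeriodicPt, IsFixedPt, hi.eq_iff]
  unfold orbitPair
  simp only [hper, hit, hu]

theorem card_orbit [Finite X] {σ : X → X} (hσ : Injective σ) (H : X) :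
    Nat.card {y : X // ∃ k, σ^[k] H = y} = minimalPeriod σ H := by
  have hx := hσ.mem_periodicPts H
  rw [← Nat.card_fin (minimalPeriod σ H)]
  symm
  refine Nat.card_congr (Equiv.ofBijective
    (fun k : Fin (minimalPeriod σ H) => (⟨σ^[k] H, k, rfl⟩ : {y : X // ∃ k, σ^[k] H = y}))
    ⟨fun a b h => ?_, ?_⟩)
  · exact Fin.ext (iterate_injOn_Iio_minimalPeriod a.2 b.2 (congrArg Subtype.val h))
  · rintro ⟨y, k, rfl⟩
    exact ⟨⟨k % minimalPeriod σ H, Nat.mod_lt _ (minimalPeriod_pos_of_mem_periodicPts hx)⟩,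
      Subtype.ext iterate_mod_minimalPeriod_eq⟩

theorem orbitPair_of_insert [Finite X] {σ : X → X} (hσ : Injective σ) {w : X → ℕ}
    {τ : Y → Y} {u : Y → ℕ} {i : X → Y} {pt : Y} (hpt : ∀ H, i H ≠ pt) {H₀ : X}
    (h₁ : τ (i H₀) = pt) (h₂ : τ pt = i (σ H₀)) (hw : u (i H₀) + u pt = w H₀ + 1)
    (hτ : ∀ H, H ≠ H₀ → τ (i H) = i (σ H)) (hu : ∀ H, H ≠ H₀ → u (i H) = w H) :
    orbitPair τ u pt = ((orbitPair σ w H₀).1 + 1, (orbitPair σ w H₀).2 + 1) ∧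
      ∀ k, ∃ j, i (σ^[k] H₀) = τ^[j] pt := by
  have hx := hσ.mem_periodicPts H₀
  obtain ⟨n, hn⟩ : ∃ n, minimalPeriod σ H₀ = n + 1 := ⟨minimalPeriod σ H₀ - 1, by
    have := minimalPeriod_pos_of_mem_periodicPts hx
    omega⟩
  have hne : ∀ k, k < n → σ^[k + 1] H₀ ≠ H₀ := fun k hk h =>
    not_isPeriodicPt_of_pos_of_lt_minimalPeriod (Nat.succ_ne_zero k) (by omega) h
  have hlast : σ^[n + 1] H₀ = H₀ := by rw [← hn]; exact iterate_minimalPeriod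
  have hit : ∀ k, k ≤ n → τ^[k + 1] pt = i (σ^[k + 1] H₀) := fun k hk => by
    induction k with
    | zero => exact h₂
    | succ k ih =>
      rw [iterate_succ_apply', ih (by omega), hτ _ (hne k (by omega)), ← iterate_succ_apply' σ]
  have hper : minimalPeriod τ pt = n + 2 := by
    have hp : IsPeriodicPt τ (n + 2) pt := by
      change τ^[n + 2] pt = pt
      rw [iterate_succ_apply', hit n le_rfl, hlast, h₁]
    refine le_antisymm (hp.minimalPeriod_le (by omega)) (not_lt.1 fun hlt => ?_)
    obtain ⟨k, hk⟩ : ∃ k, minimalPeriod τ pt = k + 1 := ⟨minimalPeriod τ pt - 1, by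
      have := hp.minimalPeriod_pos (by omega)
      omega⟩
    have := isPeriodicPt_minimalPeriod τ pt
    rw [hk] at this
    exact hpt _ ((hit k (by omega)).symm.trans this)
  constructor
  · unfold orbitPair
    refine Prod.ext (by simp [hper, hn]) ?_
    simp only [hper, hn]
    rw [Finset.sum_range_succ', Finset.sum_range_succ,
      Finset.sum_range_succ' (fun k => w (σ^[k] H₀)), hit n le_rfl, hlast,
      Finset.sum_congr rfl (g := fun k => w (σ^[k + 1] H₀)) fun k hk => by
        have hk := Finset.mem_range.1 hk
        rw [hit k hk.le, hu _ (hne k hk)]]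
    simp only [iterate_zero, id]
    omega
  · intro k
    rw [← iterate_mod_minimalPeriod_eq, hn]
    rcases hk : k % (n + 1) with _ | j
    · exact ⟨n + 1, by rw [hit n le_rfl, hlast]; rfl⟩
    · have : k % (n + 1) < n + 1 := Nat.mod_lt k (Nat.succ_pos n)
      exact ⟨j + 1, (hit j (by omega)).symm⟩

theorem card_add_of_split {X : Type*} [Finite X] (p q : X → Prop) :
    Nat.card {a // p a} = Nat.card {a // p a ∧ ¬ q a} + Nat.card {a // p a ∧ q a} := by
  classical
  have := Fintype.ofFinite X
  simp only [Nat.card_eq_fintype_card, Fintype.card_subtype]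
  rw [← Finset.filter_filter, ← Finset.filter_filter, add_comm,
    Finset.card_filter_add_card_filter_not]

theorem card_of_insert [Finite X] {i : X → Y} (hi : Injective i) {pt : Y}
    (hpt : ∀ H, i H ≠ pt) (hsurj : ∀ y, y ≠ pt → ∃ H, i H = y) (p : Y → Prop) [Decidable (p pt)] :
    Nat.card {y // p y} = Nat.card {H // p (i H)} + if p pt then 1 else 0 := by
  let e : Option X ≃ Y := Equiv.ofBijective (fun o => o.elim pt i) ⟨by
    rintro (_ | a) (_ | b) h
    · rfl
    · exact (hpt b h.symm).elim
    · exact (hpt a h).elim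
    · exact congrArg some (hi h), fun y => by
      by_cases h : y = pt
      · exact ⟨none, h.symm⟩
      · exact (hsurj y h).imp' some fun _ => id⟩
  have : Finite Y := Finite.of_equiv _ e
  rw [card_add_of_split p (fun y => y = pt)]
  congr 1
  · refine (Nat.card_congr (Equiv.ofBijective
      (fun H : {H // p (i H)} => (⟨i H.1, H.2, hpt _⟩ : {y // p y ∧ ¬ y = pt}))
      ⟨fun a b h => Subtype.ext (hi (congrArg Subtype.val h)), ?_⟩)).symm
    rintro ⟨y, hy, hne⟩
    obtain ⟨H, rfl⟩ := hsurj y hne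
    exact ⟨⟨H, hy⟩, rfl⟩
  · split_ifs with h
    · rw [Nat.card_eq_one_iff_unique]
      exact ⟨⟨fun a b => Subtype.ext (a.2.2.trans b.2.2.symm)⟩, ⟨pt, h, rfl⟩⟩
    · rw [Nat.card_eq_zero]
      exact Or.inl ⟨fun a => h (a.2.2 ▸ a.2.1)⟩

/-- Inserting a point into one orbit, raising its weight by one, changes the pair of that orbit
from `(n, m)` to `(n + 1, m + 1)` and leaves all other orbits unchanged. -/
theorem card_orbitPair_of_insert [Finite X] {σ : X → X} (hσ : Injective σ) {w : X → ℕ}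
    {τ : Y → Y} (hτi : Injective τ) {u : Y → ℕ} {i : X → Y} (hi : Injective i) {pt : Y}
    (hpt : ∀ H, i H ≠ pt) (hsurj : ∀ y, y ≠ pt → ∃ H, i H = y) {H₀ : X}
    (h₁ : τ (i H₀) = pt) (h₂ : τ pt = i (σ H₀)) (hw : u (i H₀) + u pt = w H₀ + 1)
    (hτ : ∀ H, H ≠ H₀ → τ (i H) = i (σ H)) (hu : ∀ H, H ≠ H₀ → u (i H) = w H) :
    ∃ (n m : ℕ) (g : ℕ × ℕ → ℕ), 0 < n ∧
      (∀ p, Nat.card {H // orbitPair σ w H = p} = g p + if p = (n, m) then n else 0) ∧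
      ∀ p, Nat.card {H // orbitPair τ u H = p} =
        g p + if p = (n + 1, m + 1) then n + 1 else 0 := by
  classical
  obtain ⟨hnew, hmem⟩ := orbitPair_of_insert hσ hpt h₁ h₂ hw hτ hu
  have : Finite Y := Finite.of_injective (fun y => if h : y = pt then none else
      some (hsurj y h).choose) (by
    intro a b hab
    by_cases ha : a = pt <;> by_cases hb : b = pt <;> simp only [ha, hb, dite_true, dite_false,
      reduceCtorEq, Option.some.injEq] at hab ⊢
    rw [← (hsurj a ha).choose_spec, ← (hsurj b hb).choose_spec, hab])
  have hper := minimalPeriod_pos_of_mem_periodicPts (hσ.mem_periodicPts H₀)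
  let q : X → Prop := fun H => ∃ k, σ^[k] H₀ = H
  have hin : ∀ H, q H → orbitPair σ w H = orbitPair σ w H₀ := by
    rintro _ ⟨k, rfl⟩
    exact orbitPair_iterate hσ w H₀ k
  have hin' : ∀ H, q H → orbitPair τ u (i H) = orbitPair τ u pt := by
    rintro _ ⟨k, rfl⟩
    obtain ⟨j, hj⟩ := hmem k
    rw [hj, orbitPair_iterate hτi]
  have hout : ∀ H, ¬ q H → orbitPair τ u (i H) = orbitPair σ w H := by
    intro H hH
    have hne : ∀ k, σ^[k] H ≠ H₀ := by
      intro k hk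
      apply hH
      obtain ⟨j, hj⟩ : ∃ j, k + j = minimalPeriod σ H * k :=
        ⟨minimalPeriod σ H * k - k, Nat.add_sub_cancel' (Nat.le_mul_of_pos_left k
          (minimalPeriod_pos_of_mem_periodicPts (hσ.mem_periodicPts H)))⟩
      refine ⟨j, ?_⟩
      rw [← hk, ← iterate_add_apply, add_comm, hj]
      exact (isPeriodicPt_minimalPeriod σ H).mul_const k
    exact orbitPair_map hi (fun k => hτ _ (hne k)) fun k => hu _ (hne k)
  refine ⟨(orbitPair σ w H₀).1, (orbitPair σ w H₀).2,
    fun p => Nat.card {H // orbitPair σ w H = p ∧ ¬ q H}, hper, fun p => ?_, fun p => ?_⟩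
  · rw [card_add_of_split _ q]
    congr 1
    split_ifs with h
    · rw [show (orbitPair σ w H₀).1 = minimalPeriod σ H₀ from rfl, ← card_orbit hσ H₀]
      exact Nat.card_congr (Equiv.subtypeEquivRight fun H =>
        ⟨fun hH => hH.2, fun hH => ⟨(hin H hH).trans h.symm, hH⟩⟩)
    · rw [Nat.card_eq_zero]
      exact Or.inl ⟨fun H => h (H.2.1.symm.trans (hin _ H.2.2))⟩
  · rw [card_of_insert hi hpt hsurj, card_add_of_split _ q, add_assoc]
    congr 1
    · exact Nat.card_congr (Equiv.subtypeEquivRight fun H =>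
        and_congr_left fun hH => by rw [hout H hH])
    · rw [hnew]
      by_cases h : p = ((orbitPair σ w H₀).1 + 1, (orbitPair σ w H₀).2 + 1)
      · rw [if_pos h, if_pos h.symm]
        congr 1
        rw [show (orbitPair σ w H₀).1 = minimalPeriod σ H₀ from rfl, ← card_orbit hσ H₀]
        exact Nat.card_congr (Equiv.subtypeEquivRight fun H =>
          ⟨fun hH => hH.2, fun hH => ⟨(hin' H hH).trans (hnew.trans h.symm), hH⟩⟩)
      · rw [if_neg h, if_neg (Ne.symm h), add_zero, Nat.card_eq_zero]
        exact Or.inl ⟨fun H => h (H.2.1.symm.trans ((hin' _ H.2.2).trans hnew))⟩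

/-- Adding a fixed point adds a single orbit of size one. -/
theorem card_orbitPair_of_fixed [Finite X] {σ : X → X} {w : X → ℕ}
    {τ : Y → Y} {u : Y → ℕ} {i : X → Y} (hi : Injective i) {pt : Y}
    (hpt : ∀ H, i H ≠ pt) (hsurj : ∀ y, y ≠ pt → ∃ H, i H = y) (hfix : τ pt = pt)
    (hτ : ∀ H, τ (i H) = i (σ H)) (hu : ∀ H, u (i H) = w H) (p : ℕ × ℕ) :
    Nat.card {H // orbitPair τ u H = p} =
      Nat.card {H // orbitPair σ w H = p} + if p = (1, u pt) then 1 else 0 := by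
  classical
  have hnew : orbitPair τ u pt = (1, u pt) := by
    have : minimalPeriod τ pt = 1 := minimalPeriod_eq_one_iff_isFixedPt.2 hfix
    simp [orbitPair, this]
  rw [card_of_insert hi hpt hsurj, hnew]
  congr 1
  · exact Nat.card_congr (Equiv.subtypeEquivRight fun H => by
      rw [orbitPair_map hi (fun k => hτ _) fun k => hu _])
  · exact if_congr eq_comm rfl rfl

theorem exists_multiset_of_shift {f f' : ℕ × ℕ → ℕ} (hf : f.support.Finite) {n m n' m' : ℕ}
    {g : ℕ × ℕ → ℕ} (h : ∀ p, f p = g p + if p = (n, m) then 1 else 0)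
    (h' : ∀ p, f' p = g p + if p = (n', m') then 1 else 0) :
    ∃ M : Multiset (ℕ × ℕ), (∀ p, f p = Multiset.count p ((n, m) ::ₘ M)) ∧
      ∀ p, f' p = Multiset.count p ((n', m') ::ₘ M) := by
  have hg : g.support.Finite := hf.subset fun p hp => by
    have := h p
    simp only [mem_support] at hp ⊢
    omega
  refine ⟨(Finsupp.ofSupportFinite g hg).toMultiset, fun p => ?_, fun p => ?_⟩
  · rw [Multiset.count_cons, Finsupp.count_toMultiset, h]; rfl
  · rw [Multiset.count_cons, Finsupp.count_toMultiset, h']; rfl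

end OrbitCount

/-- A nonempty chain for `r` that cannot be prolonged at either end, repetitions allowed. -/
structure MaxChain {α : Type*} (r : α → α → Prop) (l : List α) : Prop where
  ne_nil : l ≠ []
  chain : l.IsChain r
  not_left : ∀ a ∈ l.head?, ∀ c, ¬ r c a
  not_right : ∀ a ∈ l.getLast?, ∀ c, ¬ r a c

namespace MaxChain

variable {α : Type*} {r : α → α → Prop} {l l' : List α}

theorem reverse (h : MaxChain r l) : MaxChain (fun a b => r b a) l.reverse where
  ne_nil := by simpa using h.ne_nil
  chain := List.isChain_reverse.2 h.chain
  not_left := by simpa using h.not_right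
  not_right := by simpa using h.not_left

theorem eq_of_head?_eq (hr : ∀ a b c, r a b → r a c → b = c) (h : MaxChain r l)
    (h' : MaxChain r l') (hh : l.head? = l'.head?) : l = l' := by
  obtain ⟨-, hc, -, hm⟩ := h
  obtain ⟨-, hc', -, hm'⟩ := h'
  induction l generalizing l' with
  | nil => cases l' with
    | nil => rfl
    | cons b m' => simp at hh
  | cons a m ih =>
    cases l' with
    | nil => simp at hh
    | cons b m' =>
      obtain rfl : a = b := by simpa using hh
      rw [List.isChain_cons] at hc hc'
      congr 1
      cases m with
      | nil =>
        cases m' with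
        | nil => rfl
        | cons c m' => exact (hm a rfl c (hc'.1 c rfl)).elim
      | cons c m =>
        cases m' with
        | nil => exact (hm' a rfl c (hc.1 c rfl)).elim
        | cons c' m' =>
          obtain rfl : c = c' := hr a c c' (hc.1 c rfl) (hc'.1 c' rfl)
          exact ih rfl hc.2 (by simpa using hm) hc'.2 (by simpa using hm')

theorem eq_of_getLast?_eq (hr : ∀ a b c, r b a → r c a → b = c) (h : MaxChain r l)
    (h' : MaxChain r l') (hh : l.getLast? = l'.getLast?) : l = l' :=
  List.reverse_injective (h.reverse.eq_of_head?_eq hr h'.reverse (by simpa using hh))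

end MaxChain

namespace GentleAlg

variable {A : GentleAlg}

/-- The arrow `b` prolongs a forbidden path ending with `a`. -/
def ForbStep (A : GentleAlg) (a b : Fin A.nA) : Prop := A.rel b a

theorem isNontrivPermThread_iff {l : List (Fin A.nA)} :
    A.IsNontrivPermThread l ↔ MaxChain A.PermStep l := by
  constructor
  · rintro ⟨hne, hc, hl, hr⟩
    refine ⟨hne, hc, fun a ha c h => hl c ?_, fun a ha c h => hr c ?_⟩
    · refine List.isChain_cons.2 ⟨fun y hy => ?_, hc⟩
      rwa [Option.mem_unique hy ha]
    · refine List.isChain_append.2 ⟨hc, .singleton _, fun y hy z hz => ?_⟩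
      obtain rfl : c = z := by simpa using hz
      rwa [Option.mem_unique hy ha]
  · rintro ⟨hne, hc, hl, hr⟩
    refine ⟨hne, hc, fun a h => ?_, fun a h => ?_⟩
    · exact hl _ (List.head?_eq_some_head hne) a
        ((List.isChain_cons.1 h).1 _ (List.head?_eq_some_head hne))
    · exact hr _ (List.getLast?_eq_some_getLast hne) a
        ((List.isChain_append.1 h).2.2 _ (List.getLast?_eq_some_getLast hne) a rfl)

theorem isNontrivForbThread_of_maxChain {l : List (Fin A.nA)} (hn : l.Nodup)
    (h : MaxChain A.ForbStep l) : A.IsNontrivForbThread l := by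
  obtain ⟨hne, hc, hl, hr⟩ := h
  refine ⟨hne, ⟨hn, hc⟩, fun a h => ?_, fun a h => ?_⟩
  · exact hl _ (List.head?_eq_some_head hne) a
      ((List.isChain_cons.1 h.2).1 _ (List.head?_eq_some_head hne))
  · exact hr _ (List.getLast?_eq_some_getLast hne) a
      ((List.isChain_append.1 h.2).2.2 _ (List.getLast?_eq_some_getLast hne) a rfl)

theorem card_fiber_le_one_iff {n k : ℕ} (f : Fin n → Fin k) (v : Fin k) :
    Nat.card {a // f a = v} ≤ 1 ↔ ∀ a b, f a = v → f b = v → a = b := by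
  rw [Finite.card_le_one_iff_subsingleton]
  exact ⟨fun h a b ha hb => congrArg Subtype.val (h.elim ⟨a, ha⟩ ⟨b, hb⟩),
    fun h => ⟨fun a b => Subtype.ext (h _ _ a.2 b.2)⟩⟩

theorem eq_of_card_fiber_le_two {n k : ℕ} {f : Fin n → Fin k} {v : Fin k}
    (h : Nat.card {a // f a = v} ≤ 2) {a b c : Fin n} (ha : f a = v) (hb : f b = v)
    (hc : f c = v) (hab : a ≠ b) (hac : a ≠ c) : b = c := by
  by_contra hbc
  rw [Nat.card_eq_fintype_card, Fintype.card_subtype] at h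
  have : ({a, b, c} : Finset (Fin n)) ⊆ Finset.univ.filter fun a => f a = v := by
    intro y hy
    simp only [Finset.mem_insert, Finset.mem_singleton] at hy
    rcases hy with rfl | rfl | rfl <;> simp [*]
  have := Finset.card_le_card this
  rw [Finset.card_eq_three.2 ⟨a, b, c, hab, hac, hbc, rfl⟩] at this
  omega

/-- The first arrow of a permitted thread, if it is non-trivial. -/
def pFirst : A.PermThread → Option (Fin A.nA)
  | .inl l => l.1.head?
  | .inr _ => none

/-- The last arrow of a permitted thread, if it is non-trivial. -/
def pLast : A.PermThread → Option (Fin A.nA)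
  | .inl l => l.1.getLast?
  | .inr _ => none

/-- The first arrow of a forbidden thread, if it is non-trivial. -/
def fFirst : A.ForbThread → Option (Fin A.nA)
  | .inl l => l.1.head?
  | .inr _ => none

/-- The last arrow of a forbidden thread, if it is non-trivial. -/
def fLast : A.ForbThread → Option (Fin A.nA)
  | .inl l => l.1.getLast?
  | .inr _ => none

theorem src_of_pFirst {H : A.PermThread} {a : Fin A.nA} (h : pFirst H = some a) :
    A.src a = A.pStart H := by
  rcases H with ⟨l, hl⟩ | v
  · simp only [pFirst] at h
    rw [List.head?_eq_some_head hl.1, Option.some.injEq] at h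
    rw [← h]; rfl
  · simp [pFirst] at h

theorem tgt_of_pLast {H : A.PermThread} {a : Fin A.nA} (h : pLast H = some a) :
    A.tgt a = A.pEnd H := by
  rcases H with ⟨l, hl⟩ | v
  · simp only [pLast] at h
    rw [List.getLast?_eq_some_getLast hl.1, Option.some.injEq] at h
    rw [← h]; rfl
  · simp [pLast] at h

theorem src_of_fFirst {F : A.ForbThread} {a : Fin A.nA} (h : fFirst F = some a) :
    A.src a = A.fStart F := by
  rcases F with ⟨l, hl⟩ | v
  · simp only [fFirst] at h
    rw [List.head?_eq_some_head hl.1, Option.some.injEq] at h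
    rw [← h]; rfl
  · simp [fFirst] at h

theorem tgt_of_fLast {F : A.ForbThread} {a : Fin A.nA} (h : fLast F = some a) :
    A.tgt a = A.fEnd F := by
  rcases F with ⟨l, hl⟩ | v
  · simp only [fLast] at h
    rw [List.getLast?_eq_some_getLast hl.1, Option.some.injEq] at h
    rw [← h]; rfl
  · simp [fLast] at h

theorem not_permStep_of_pFirst {H : A.PermThread} {a : Fin A.nA} (h : pFirst H = some a)
    (c : Fin A.nA) : ¬ A.PermStep c a := by
  rcases H with ⟨l, hl⟩ | v
  · exact (isNontrivPermThread_iff.1 hl).not_left a h c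
  · simp [pFirst] at h

theorem not_permStep_of_pLast {H : A.PermThread} {a : Fin A.nA} (h : pLast H = some a)
    (c : Fin A.nA) : ¬ A.PermStep a c := by
  rcases H with ⟨l, hl⟩ | v
  · exact (isNontrivPermThread_iff.1 hl).not_right a h c
  · simp [pLast] at h

theorem eq_inr_of_pFirst_eq_none {H : A.PermThread} (h : pFirst H = none) :
    ∃ v, H = Sum.inr v := by
  rcases H with ⟨l, hl⟩ | v
  · exact (hl.1 (List.head?_eq_none_iff.1 h)).elim
  · exact ⟨v, rfl⟩

theorem eq_inr_of_pLast_eq_none {H : A.PermThread} (h : pLast H = none) :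
    ∃ v, H = Sum.inr v := by
  rcases H with ⟨l, hl⟩ | v
  · exact (hl.1 (List.getLast?_eq_none_iff.1 h)).elim
  · exact ⟨v, rfl⟩

theorem eq_inr_of_fFirst_eq_none {F : A.ForbThread} (h : fFirst F = none) :
    ∃ v, F = Sum.inr v := by
  rcases F with ⟨l, hl⟩ | v
  · exact (hl.1 (List.head?_eq_none_iff.1 h)).elim
  · exact ⟨v, rfl⟩

theorem eq_inr_of_fLast_eq_none {F : A.ForbThread} (h : fLast F = none) :
    ∃ v, F = Sum.inr v := by
  rcases F with ⟨l, hl⟩ | v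
  · exact (hl.1 (List.getLast?_eq_none_iff.1 h)).elim
  · exact ⟨v, rfl⟩

theorem permThread_ext {H H' : A.PermThread} (hf : pFirst H = pFirst H')
    (hs : A.pStart H = A.pStart H') : H = H' := by
  rcases H with ⟨l, hl⟩ | v <;> rcases H' with ⟨l', hl'⟩ | v'
  · have : l = l' := (isNontrivPermThread_iff.1 hl).eq_of_head?_eq
      (fun a b c hb hc => A.perm_succ_unique a b c hb.1.symm hb.2 hc.1.symm hc.2)
      (isNontrivPermThread_iff.1 hl') hf
    subst this; rfl
  · exact (hl.1 (List.head?_eq_none_iff.1 hf)).elim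
  · exact (hl'.1 (List.head?_eq_none_iff.1 hf.symm)).elim
  · exact congrArg Sum.inr (Subtype.ext hs)

instance : Finite A.PermThread :=
  Finite.of_injective (fun H => (pFirst H, A.pStart H)) fun _ _ h =>
    permThread_ext (Prod.mk.inj h).1 (Prod.mk.inj h).2

/-- The forbidden thread `F` ends where the permitted thread `H` ends, on the opposite side. -/
def EndRel (H : A.PermThread) (F : A.ForbThread) : Prop :=
  A.fEnd F = A.pEnd H ∧ (pLast H ≠ fLast F ∨ ∀ a, A.tgt a ≠ A.pEnd H)

/-- The permitted thread `H` starts where the forbidden thread `F` starts, on the opposite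
side. -/
def StartRel (F : A.ForbThread) (H : A.PermThread) : Prop :=
  A.pStart H = A.fStart F ∧ (pFirst H ≠ fFirst F ∨ ∀ a, A.src a ≠ A.pStart H)

theorem endRel_of_signs (S : A.Signs) {H : A.PermThread} {F : A.ForbThread}
    (hv : A.fEnd F = A.pEnd H) (hs : S.fEps F = ! S.pEps H) : EndRel H F := by
  refine ⟨hv, or_iff_not_imp_left.2 fun hne a ha => ?_⟩
  have heq := not_not.1 hne
  rcases H with ⟨l, hl⟩ | ⟨v, hv'⟩ <;> rcases F with ⟨l', hl'⟩ | ⟨u, hu⟩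
  · simp only [pLast, fLast, List.getLast?_eq_some_getLast hl.1,
      List.getLast?_eq_some_getLast hl'.1, Option.some.injEq] at heq
    simp [Signs.fEps, Signs.pEps, heq] at hs
  · exact hl.1 (List.getLast?_eq_none_iff.1 heq)
  · exact hl'.1 (List.getLast?_eq_none_iff.1 heq.symm)
  · obtain rfl : u = v := hv
    have hin : ∃ b, A.tgt b = u := ⟨a, ha⟩
    have hout : ¬ ∃ c, A.src c = u := fun ⟨c, hc⟩ => hv'.2.2 a c ha hc (hu.2.2 a c ha hc)
    simp [Signs.fEps, Signs.pEps, Signs.fTrivSgn, Signs.pTrivSgn, hin, hout] at hs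

theorem startRel_of_signs (S : A.Signs) {H : A.PermThread} {F : A.ForbThread}
    (hv : A.pStart H = A.fStart F) (hs : S.pSgn H = ! S.fSgn F) : StartRel F H := by
  refine ⟨hv, or_iff_not_imp_left.2 fun hne a ha => ?_⟩
  have heq := not_not.1 hne
  rcases H with ⟨l, hl⟩ | ⟨v, hv'⟩ <;> rcases F with ⟨l', hl'⟩ | ⟨u, hu⟩
  · simp only [pFirst, fFirst, List.head?_eq_some_head hl.1,
      List.head?_eq_some_head hl'.1, Option.some.injEq] at heq
    simp [Signs.fSgn, Signs.pSgn, heq] at hs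
  · exact hl.1 (List.head?_eq_none_iff.1 heq)
  · exact hl'.1 (List.head?_eq_none_iff.1 heq.symm)
  · obtain rfl : v = u := hv
    have hout : ∃ c, A.src c = v := ⟨a, ha⟩
    simp [Signs.fSgn, Signs.pSgn, Signs.fTrivSgn, Signs.pTrivSgn, hout] at hs

theorem EndRel.not_rel {H : A.PermThread} {F : A.ForbThread} (h : EndRel H F) {z : Fin A.nA}
    (hz : fLast F = some z) (c : Fin A.nA) : ¬ A.rel c z := by
  intro hr
  have hzv : A.tgt z = A.pEnd H := (tgt_of_fLast hz).trans h.1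
  rcases hH : pLast H with _ | y
  · obtain ⟨⟨v, hv⟩, rfl⟩ := eq_inr_of_pLast_eq_none hH
    exact hv.2.2 z c hzv ((A.rel_comp _ _ hr).trans hzv) hr
  · rcases h.2 with h2 | h2
    · refine not_permStep_of_pLast hH c
        ⟨(tgt_of_pLast hH).trans (hzv.symm.trans (A.rel_comp _ _ hr).symm), fun hr' => h2 ?_⟩
      rw [hH, hz, A.rel_pred_unique c z y hr hr']
    · exact h2 z hzv

theorem StartRel.not_rel {H : A.PermThread} {F : A.ForbThread} (h : StartRel F H)
    {z : Fin A.nA} (hz : fFirst F = some z) (c : Fin A.nA) : ¬ A.rel z c := by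
  intro hr
  have hzv : A.src z = A.pStart H := (src_of_fFirst hz).trans h.1.symm
  rcases hH : pFirst H with _ | y
  · obtain ⟨⟨v, hv⟩, rfl⟩ := eq_inr_of_pFirst_eq_none hH
    exact hv.2.2 c z ((A.rel_comp _ _ hr).symm.trans hzv) hzv hr
  · rcases h.2 with h2 | h2
    · refine not_permStep_of_pFirst hH c
        ⟨(A.rel_comp _ _ hr).symm.trans (hzv.trans (src_of_pFirst hH).symm), fun hr' => h2 ?_⟩
      rw [hH, hz, A.rel_succ_unique c z y hr hr']
    · exact h2 z hzv

theorem maxChain_of_endRel_startRel {H H' : A.PermThread}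
    {l : {l // A.IsNontrivForbThread l}} (h : EndRel H (.inl l)) (h' : StartRel (.inl l) H') :
    MaxChain A.ForbStep l.1 :=
  ⟨l.2.1, l.2.2.1.2, fun _ ha c => h'.not_rel ha c, fun _ ha c => h.not_rel ha c⟩

theorem EndRel.fLast_unique {H : A.PermThread} {F F' : A.ForbThread} (h : EndRel H F)
    (h' : EndRel H F') : fLast F = fLast F' := by
  rcases hF : fLast F with _ | y <;> rcases hF' : fLast F' with _ | y'
  · rfl
  · obtain ⟨⟨u, hu⟩, rfl⟩ := eq_inr_of_fLast_eq_none hF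
    have hy' := (tgt_of_fLast hF').trans h'.1
    rcases hH : pLast H with _ | z
    · rcases h.2 with h2 | h2
      · exact (h2 hH).elim
      · exact (h2 _ hy').elim
    · rcases h'.2 with h2 | h2
      · refine (h2 ?_).elim
        rw [hH, hF', (card_fiber_le_one_iff _ _).1 hu.2.1 z y'
          ((tgt_of_pLast hH).trans h.1.symm) (hy'.trans h.1.symm)]
      · exact (h2 _ hy').elim
  · obtain ⟨⟨u, hu⟩, rfl⟩ := eq_inr_of_fLast_eq_none hF'
    have hy := (tgt_of_fLast hF).trans h.1
    rcases hH : pLast H with _ | z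
    · rcases h'.2 with h2 | h2
      · exact (h2 hH).elim
      · exact (h2 _ hy).elim
    · rcases h.2 with h2 | h2
      · refine (h2 ?_).elim
        rw [hH, hF, (card_fiber_le_one_iff _ _).1 hu.2.1 z y
          ((tgt_of_pLast hH).trans h'.1.symm) (hy.trans h'.1.symm)]
      · exact (h2 _ hy).elim
  · have hy := (tgt_of_fLast hF).trans h.1
    have hy' := (tgt_of_fLast hF').trans h'.1
    rcases hH : pLast H with _ | z
    · obtain ⟨⟨v, hv⟩, rfl⟩ := eq_inr_of_pLast_eq_none hH
      rw [(card_fiber_le_one_iff _ _).1 hv.2.1 y y' hy hy']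
    · have h1 := h.2.resolve_right fun h2 => h2 _ hy
      have h2 := h'.2.resolve_right fun h2 => h2 _ hy
      rw [hH, hF, Ne, Option.some.injEq] at h1
      rw [hH, hF', Ne, Option.some.injEq] at h2
      rw [eq_of_card_fiber_le_two (A.in_le_two _) (tgt_of_pLast hH) hy hy' h1 h2]

theorem StartRel.pFirst_unique {H H' : A.PermThread} {F : A.ForbThread} (h : StartRel F H)
    (h' : StartRel F H') : pFirst H = pFirst H' := by
  have hss := h.1.trans h'.1.symm
  rcases hH : pFirst H with _ | y <;> rcases hH' : pFirst H' with _ | y'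
  · rfl
  · obtain ⟨⟨v, hv⟩, rfl⟩ := eq_inr_of_pFirst_eq_none hH
    have hy' := src_of_pFirst hH'
    rcases hF : fFirst F with _ | z
    · rcases h.2 with h2 | h2
      · exact (h2 (hH.trans hF.symm)).elim
      · exact (h2 _ (hy'.trans hss.symm)).elim
    · rcases h'.2 with h2 | h2
      · refine (h2 ?_).elim
        rw [hH', hF, (card_fiber_le_one_iff _ _).1 hv.1 z y'
          ((src_of_fFirst hF).trans h.1.symm) (hy'.trans hss.symm)]
      · exact (h2 _ hy').elim
  · obtain ⟨⟨v, hv⟩, rfl⟩ := eq_inr_of_pFirst_eq_none hH'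
    have hy := src_of_pFirst hH
    rcases hF : fFirst F with _ | z
    · rcases h'.2 with h2 | h2
      · exact (h2 (hH'.trans hF.symm)).elim
      · exact (h2 _ (hy.trans hss)).elim
    · rcases h.2 with h2 | h2
      · refine (h2 ?_).elim
        rw [hH, hF, (card_fiber_le_one_iff _ _).1 hv.1 z y
          ((src_of_fFirst hF).trans h'.1.symm) (hy.trans hss)]
      · exact (h2 _ hy).elim
  · have hy := src_of_pFirst hH
    have hy' := (src_of_pFirst hH').trans hss.symm
    rcases hF : fFirst F with _ | z
    · obtain ⟨⟨v, hv⟩, rfl⟩ := eq_inr_of_fFirst_eq_none hF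
      rw [(card_fiber_le_one_iff _ _).1 hv.1 y y' (hy.trans h.1) (hy'.trans h.1)]
    · have h1 := h.2.resolve_right fun h2 => h2 _ hy
      have h2 := h'.2.resolve_right fun h2 => h2 _ (src_of_pFirst hH')
      rw [hH, hF, Ne, Option.some.injEq] at h1
      rw [hH', hF, Ne, Option.some.injEq] at h2
      rw [eq_of_card_fiber_le_two (A.out_le_two _) ((src_of_fFirst hF).trans h.1.symm) hy hy'
        (Ne.symm h1) (Ne.symm h2)]

theorem AGPairing.endRel {S : A.Signs} (P : A.AGPairing S) (H : A.PermThread) :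
    EndRel H (P.forb H) :=
  endRel_of_signs S (P.end_forb H) (P.eps_forb H)

theorem AGPairing.startRel {S : A.Signs} (P : A.AGPairing S) (H : A.PermThread) :
    StartRel (P.forb H) (P.next H) :=
  startRel_of_signs S (P.start_next H) (P.sgn_next H)

/-- The pairing algorithm does not depend on the choice of signs: its steps are determined by
the incidence of the threads at their end points. -/
theorem AGPairing.eq_of_rel {S : A.Signs} (P : A.AGPairing S) {H H' : A.PermThread}
    {F : A.ForbThread} (h : EndRel H F) (h' : StartRel F H') : P.forb H = F ∧ P.next H = H' := by
  have hF : P.forb H = F := by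
    have e := P.endRel H
    have s := P.startRel H
    have hl := e.fLast_unique h
    revert e s hl
    generalize P.next H = K
    generalize P.forb H = G
    intro e s hl
    rcases G with l | v <;> rcases F with l' | v'
    · exact congrArg Sum.inl (Subtype.ext ((maxChain_of_endRel_startRel e s).eq_of_getLast?_eq
        (fun a b c => A.rel_pred_unique a b c) (maxChain_of_endRel_startRel h h') hl))
    · exact (l.2.1 (List.getLast?_eq_none_iff.1 hl)).elim
    · exact (l'.2.1 (List.getLast?_eq_none_iff.1 hl.symm)).elim
    · exact congrArg Sum.inr (Subtype.ext (e.1.trans h.1.symm))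
  refine ⟨hF, ?_⟩
  have s := P.startRel H
  rw [hF] at s
  exact permThread_ext (s.pFirst_unique h') (s.1.trans h'.1.symm)

/-- The arrows of a forbidden thread. -/
def fArrows : A.ForbThread → List (Fin A.nA)
  | .inl l => l.1
  | .inr _ => []

theorem isRelCycle_cons_iff {a : Fin A.nA} {l : List (Fin A.nA)} :
    A.IsRelCycle (a :: l) ↔ (a :: l).Nodup ∧ (a :: (l ++ [a])).IsChain A.ForbStep := by
  rw [← List.cons_append, List.isChain_append]
  constructor
  · rintro ⟨-, hn, hc, h, z, hh, hz, hr⟩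
    refine ⟨hn, hc, .singleton _, fun y hy w hw => ?_⟩
    rw [Option.mem_unique hy hz, show w = h by simp_all]
    exact hr
  · rintro ⟨hn, hc, -, h⟩
    exact ⟨List.cons_ne_nil _ _, hn, hc, a, _, rfl, List.getLast?_eq_some_getLast (by simp),
      h _ (List.getLast?_eq_some_getLast (by simp)) a rfl⟩

theorem isRelCycle_iff {l : List (Fin A.nA)} :
    A.IsRelCycle l ↔ l ≠ [] ∧ l.Nodup ∧ Cycle.Chain A.ForbStep (l : Cycle (Fin A.nA)) := by
  cases l with
  | nil => exact ⟨fun h => (h.1 rfl).elim, fun h => (h.1 rfl).elim⟩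
  | cons a l =>
    rw [isRelCycle_cons_iff, Cycle.chain_coe_cons]
    simp

theorem IsRelCycle.of_isRotated {l l' : List (Fin A.nA)} (h : A.IsRelCycle l) (hl : l ~r l') :
    A.IsRelCycle l' := by
  rw [isRelCycle_iff] at h ⊢
  refine ⟨fun h' => h.1 ?_, hl.nodup_iff.1 h.2.1, ?_⟩
  · subst h'
    exact List.isRotated_nil_iff.1 hl
  · rw [← Cycle.coe_eq_coe.2 hl]
    exact h.2.2

theorem IsRelCycle.exists_isRotated {l : List (Fin A.nA)} (h : A.IsRelCycle l) {a : Fin A.nA}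
    (ha : a ∈ l) : ∃ m, l ~r (a :: m) ∧ A.IsRelCycle (a :: m) := by
  obtain ⟨l₁, l₂, rfl⟩ := List.append_of_mem ha
  have hr : (l₁ ++ a :: l₂) ~r (a :: (l₂ ++ l₁)) := by
    rw [← List.cons_append]
    exact List.isRotated_append
  exact ⟨_, hr, h.of_isRotated hr⟩

theorem IsRelCycle.exists_forbStep_right {l : List (Fin A.nA)} (h : A.IsRelCycle l)
    {a : Fin A.nA} (ha : a ∈ l) : ∃ b ∈ l, A.ForbStep a b := by
  obtain ⟨m, hr, hm⟩ := h.exists_isRotated ha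
  have hc := (isRelCycle_cons_iff.1 hm).2
  cases m with
  | nil => exact ⟨a, ha, (List.isChain_cons_cons.1 hc).1⟩
  | cons b m => exact ⟨b, hr.mem_iff.2 (by simp), (List.isChain_cons_cons.1 hc).1⟩

theorem IsRelCycle.exists_forbStep_left {l : List (Fin A.nA)} (h : A.IsRelCycle l)
    {a : Fin A.nA} (ha : a ∈ l) : ∃ b, A.ForbStep b a := by
  obtain ⟨m, -, hm⟩ := h.exists_isRotated ha
  have hc := (isRelCycle_cons_iff.1 hm).2
  rw [← List.cons_append, List.isChain_append] at hc
  exact ⟨_, hc.2.2 _ (List.getLast?_eq_some_getLast (by simp)) a rfl⟩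

/-- An arrow of a full cycle of relations does not belong to any maximal forbidden path. -/
theorem IsRelCycle.notMem_maxChain {l m : List (Fin A.nA)} (h : A.IsRelCycle l)
    (hm : MaxChain A.ForbStep m) {a : Fin A.nA} (ha : a ∈ l) : a ∉ m := by
  intro ham
  obtain ⟨m₁, m₂, rfl⟩ := List.append_of_mem ham
  have key : ∀ (k : List (Fin A.nA)) (b : Fin A.nA), b ∈ l → (b :: k).IsChain A.ForbStep →
      (b :: k).getLast (List.cons_ne_nil _ _) ∈ l := by
    intro k
    induction k with
    | nil => exact fun b hb _ => hb
    | cons c k ih =>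
      intro b hb hc
      rw [List.isChain_cons_cons] at hc
      obtain ⟨c', hc', hbc⟩ := h.exists_forbStep_right hb
      obtain rfl : c = c' := A.rel_succ_unique b c c' hc.1 hbc
      exact ih c hc' hc.2
  obtain ⟨c, -, hc⟩ := h.exists_forbStep_right (key m₂ a ha hm.chain.right_of_append)
  refine hm.not_right _ ?_ c hc
  rw [List.getLast?_append_of_ne_nil _ (List.cons_ne_nil _ _)]
  exact List.getLast?_eq_some_getLast _

theorem IsRelCycle.tail_eq {a : Fin A.nA} {l m : List (Fin A.nA)} (hl : A.IsRelCycle (a :: l))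
    (hm : A.IsRelCycle (a :: m)) : l = m := by
  have key : ∀ (l m : List (Fin A.nA)) (b : Fin A.nA), a ∉ l → a ∉ m →
      (b :: (l ++ [a])).IsChain A.ForbStep → (b :: (m ++ [a])).IsChain A.ForbStep → l = m := by
    intro l
    induction l with
    | nil =>
      intro m b _ hm hl' hm'
      cases m with
      | nil => rfl
      | cons c m =>
        have h1 := (List.isChain_cons_cons.1 hl').1
        have h2 := (List.isChain_cons_cons.1 hm').1
        exact (hm (A.rel_succ_unique b a c h1 h2 ▸ List.mem_cons_self)).elim
    | cons e l ih =>
      intro m b hl hm hl' hm'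
      obtain ⟨h1, h1'⟩ := List.isChain_cons_cons.1 hl'
      cases m with
      | nil =>
        have h2 := (List.isChain_cons_cons.1 hm').1
        exact (hl (A.rel_succ_unique b a e h2 h1 ▸ List.mem_cons_self)).elim
      | cons c m =>
        obtain ⟨h2, h2'⟩ := List.isChain_cons_cons.1 hm'
        obtain rfl : e = c := A.rel_succ_unique b e c h1 h2
        rw [ih m e (fun h => hl (List.mem_cons_of_mem _ h))
          (fun h => hm (List.mem_cons_of_mem _ h)) h1' h2']
  rw [isRelCycle_cons_iff] at hl hm
  exact key l m a (List.nodup_cons.1 hl.1).1 (List.nodup_cons.1 hm.1).1 hl.2 hm.2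

/-- The number of full cycles of relations of length `q`, counted with a base point. -/
noncomputable def relCycleCount (A : GentleAlg) (q : ℕ) : ℕ :=
  {l : List (Fin A.nA) | A.IsRelCycle l ∧ l.length = q}.ncard

theorem IsRelCycle.ncard_mem {a : Fin A.nA} {l : List (Fin A.nA)} (h : A.IsRelCycle (a :: l))
    (q : ℕ) : {m : List (Fin A.nA) | (A.IsRelCycle m ∧ m.length = q) ∧ a ∈ m}.ncard =
      if q = (a :: l).length then (a :: l).length else 0 := by
  have hmem : ∀ m, (A.IsRelCycle m ∧ a ∈ m) ↔ m ∈ (a :: l).cyclicPermutations := by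
    intro m
    rw [List.mem_cyclicPermutations_iff]
    constructor
    · rintro ⟨hm, ha⟩
      obtain ⟨k, hr, hk⟩ := hm.exists_isRotated ha
      rwa [← hk.tail_eq h]
    · exact fun hr => ⟨h.of_isRotated hr.symm, hr.symm.mem_iff.1 List.mem_cons_self⟩
  have hlen : ∀ m ∈ (a :: l).cyclicPermutations, m.length = (a :: l).length := fun m hm =>
    (List.mem_cyclicPermutations_iff.1 hm).perm.length_eq
  split_ifs with hq
  · have hset : {m : List (Fin A.nA) | (A.IsRelCycle m ∧ m.length = q) ∧ a ∈ m} =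
        ((a :: l).cyclicPermutations.toFinset : Set (List (Fin A.nA))) := by
      ext m
      simp only [Set.mem_ofPred_eq, Finset.mem_coe, List.mem_toFinset, ← hmem]
      refine ⟨fun h => ⟨h.1.1, h.2⟩, fun h => ⟨⟨h.1, ?_⟩, h.2⟩⟩
      rw [hq]
      exact hlen m ((hmem m).1 h)
    rw [hset, Set.ncard_coe_finset, List.toFinset_card_of_nodup h.2.1.cyclicPermutations,
      List.length_cyclicPermutations_of_ne_nil _ h.1]
  · rw [Set.ncard_eq_zero ((List.finite_length_eq _ q).subset fun m h => h.1.2)]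
    refine Set.eq_empty_of_forall_notMem fun m hm => hq ?_
    rw [← hm.1.2]
    exact hlen m ((hmem m).1 ⟨hm.1.1, hm.2⟩)

theorem relCycleCount_eq_add (a : Fin A.nA) (q : ℕ) :
    A.relCycleCount q =
      {l : List (Fin A.nA) | (A.IsRelCycle l ∧ l.length = q) ∧ a ∉ l}.ncard +
        {l : List (Fin A.nA) | (A.IsRelCycle l ∧ l.length = q) ∧ a ∈ l}.ncard := by
  have hf : {l : List (Fin A.nA) | A.IsRelCycle l ∧ l.length = q}.Finite :=
    (List.finite_length_eq _ q).subset fun m h => h.2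
  rw [add_comm, relCycleCount, ← Set.ncard_inter_add_ncard_sdiff_eq_ncard _ {l | a ∈ l} hf]
  rfl

end GentleAlg

/-- The contraction at a transition vertex `x`: the vertex and arrow sets of `B` embed into those
of `A`, the contracted arrow `γ` being read either as `α` (as a source) or as `β` (as a
target). -/
structure Contraction (A B : GentleAlg) (x : Fin A.nV) (α β : Fin A.nA) where
  v : Fin B.nV → Fin A.nV
  s : Fin B.nA → Fin A.nA
  t : Fin B.nA → Fin A.nA
  γ : Fin B.nA
  v_inj : Function.Injective v
  s_inj : Function.Injective s
  t_inj : Function.Injective t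
  v_ne : ∀ u, v u ≠ x
  exists_v : ∀ y, y ≠ x → ∃ u, v u = y
  s_γ : s γ = α
  t_γ : t γ = β
  s_eq_t : ∀ b, b ≠ γ → s b = t b
  s_ne : ∀ b, s b ≠ β
  t_ne : ∀ b, t b ≠ α
  exists_s : ∀ a, a ≠ β → ∃ b, s b = a
  exists_t : ∀ a, a ≠ α → ∃ b, t b = a
  src_s : ∀ b, A.src (s b) = v (B.src b)
  tgt_t : ∀ b, A.tgt (t b) = v (B.tgt b)
  rel_iff : ∀ b a, B.rel b a ↔ A.rel (s b) (t a)
  tgt_α : A.tgt α = x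
  src_β : A.src β = x
  eq_α : ∀ a, A.tgt a = x → a = α
  eq_β : ∀ a, A.src a = x → a = β
  not_rel : ¬ A.rel β α

theorem GentleAlg.IsContraction.nonempty_contraction {A B : GentleAlg} {x : Fin A.nV}
    {α β : Fin A.nA} (ht : A.TransitionAt x α β) (hB : A.IsContraction x α β B) :
    Nonempty (Contraction A B x α β) := by
  obtain ⟨hne, htα, hsβ, hα, hβ, hnr⟩ := ht
  obtain ⟨ev, ea, h1, h2, h3, h4, h5, h6, h7, h8⟩ := hB
  have hsα : A.src α ≠ x := fun h => hne (hβ _ h)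
  have htβ : A.tgt β ≠ x := fun h => hne (hα _ h).symm
  have hs : ∀ a : {a : Fin A.nA // a ≠ α ∧ a ≠ β}, A.src a.1 ≠ x := fun a h => a.2.2 (hβ _ h)
  have htt : ∀ a : {a : Fin A.nA // a ≠ α ∧ a ≠ β}, A.tgt a.1 ≠ x := fun a h => a.2.1 (hα _ h)
  have forall_arrow : ∀ p : Fin B.nA → Prop, p (ea none) → (∀ a, p (ea (some a))) → ∀ b, p b := by
    intro p hn hsm b
    obtain ⟨o, rfl⟩ := ea.surjective b
    cases o with
    | none => exact hn
    | some a => exact hsm a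
  let s : Fin B.nA → Fin A.nA := fun b => (ea.symm b).elim α Subtype.val
  let t : Fin B.nA → Fin A.nA := fun b => (ea.symm b).elim β Subtype.val
  have sn : s (ea none) = α := by simp [s]
  have tn : t (ea none) = β := by simp [t]
  have ss : ∀ a, s (ea (some a)) = a.1 := fun a => by simp [s]
  have ts : ∀ a, t (ea (some a)) = a.1 := fun a => by simp [t]
  refine ⟨{
    v := fun u => (ev.symm u).1
    s := s
    t := t
    γ := ea none
    v_inj := Subtype.val_injective.comp ev.symm.injective
    s_inj := ?_
    t_inj := ?_
    v_ne := fun u => (ev.symm u).2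
    exists_v := fun y hy => ⟨ev ⟨y, hy⟩, by simp⟩
    s_γ := sn
    t_γ := tn
    s_eq_t := ?_
    s_ne := ?_
    t_ne := ?_
    exists_s := ?_
    exists_t := ?_
    src_s := ?_
    tgt_t := ?_
    rel_iff := ?_
    tgt_α := htα
    src_β := hsβ
    eq_α := hα
    eq_β := hβ
    not_rel := hnr }⟩
  · refine forall_arrow _ (forall_arrow _ (fun _ => rfl) fun a h => ?_) fun a => ?_
    · rw [sn, ss] at h
      exact (a.2.1 h.symm).elim
    · refine forall_arrow _ (fun h => ?_) fun a' h => ?_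
      · rw [sn, ss] at h
        exact (a.2.1 h).elim
      · rw [ss, ss] at h
        rw [Subtype.ext h]
  · refine forall_arrow _ (forall_arrow _ (fun _ => rfl) fun a h => ?_) fun a => ?_
    · rw [tn, ts] at h
      exact (a.2.2 h.symm).elim
    · refine forall_arrow _ (fun h => ?_) fun a' h => ?_
      · rw [tn, ts] at h
        exact (a.2.2 h).elim
      · rw [ts, ts] at h
        rw [Subtype.ext h]
  · exact forall_arrow _ (fun h => (h rfl).elim) fun a _ => by rw [ss, ts]
  · exact forall_arrow _ (by rwa [sn]) fun a => by rw [ss]; exact a.2.2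
  · exact forall_arrow _ (by rw [tn]; exact hne.symm) fun a => by rw [ts]; exact a.2.1
  · intro a ha
    by_cases h : a = α
    · exact ⟨ea none, sn.trans h.symm⟩
    · exact ⟨ea (some ⟨a, h, ha⟩), ss _⟩
  · intro a ha
    by_cases h : a = β
    · exact ⟨ea none, tn.trans h.symm⟩
    · exact ⟨ea (some ⟨a, ha, h⟩), ts _⟩
  · exact forall_arrow _ (by rw [sn, h3 hsα]; simp) fun a => by rw [ss, h1 a (hs a)]; simp
  · exact forall_arrow _ (by rw [tn, h4 htβ]; simp) fun a => by rw [ts, h2 a (htt a)]; simp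
  · refine forall_arrow _ (forall_arrow _ ?_ fun a => ?_) fun b => forall_arrow _ ?_ fun a => ?_
    · rw [sn, tn]; exact h8
    · rw [sn, ts]; exact h7 a
    · rw [ss, tn]; exact h6 b
    · rw [ss, ts]; exact h5 b a

namespace Contraction

open GentleAlg

variable {A B : GentleAlg} {x : Fin A.nV} {α β : Fin A.nA} (d : Contraction A B x α β)

theorem ne (d : Contraction A B x α β) : α ≠ β := d.s_γ ▸ d.s_ne d.γ

theorem permStep_iff {a b : Fin B.nA} : B.PermStep a b ↔ A.PermStep (d.t a) (d.s b) := by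
  simp only [PermStep, d.tgt_t, d.src_s, d.rel_iff, d.v_inj.eq_iff (a := B.tgt a)]

theorem forbStep_iff {a b : Fin B.nA} : B.ForbStep a b ↔ A.ForbStep (d.t a) (d.s b) :=
  d.rel_iff b a

theorem permStep (d : Contraction A B x α β) : A.PermStep α β := ⟨d.tgt_α.trans d.src_β.symm, d.not_rel⟩

theorem exists_s_of_tgt_eq {b : Fin B.nA} {c : Fin A.nA} (h : A.tgt (d.t b) = A.src c) :
    ∃ c', d.s c' = c :=
  d.exists_s c fun hc => d.t_ne b (d.eq_α _ (by rw [h, hc, d.src_β]))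

theorem exists_t_of_tgt_eq {b : Fin B.nA} {c : Fin A.nA} (h : A.tgt c = A.src (d.s b)) :
    ∃ c', d.t c' = c :=
  d.exists_t c fun hc => d.s_ne b (d.eq_β _ (by rw [← h, hc, d.tgt_α]))

theorem not_forbStep_α (d : Contraction A B x α β) (c : Fin A.nA) : ¬ A.ForbStep α c := by
  intro h
  have hc := d.eq_β c ((A.rel_comp _ _ h).trans d.tgt_α)
  exact d.not_rel (hc ▸ h)

theorem not_forbStep_β (d : Contraction A B x α β) (c : Fin A.nA) : ¬ A.ForbStep c β := by
  intro h
  have hc := d.eq_α c ((A.rel_comp _ _ h).symm.trans d.src_β)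
  exact d.not_rel (hc ▸ h)

theorem exists_src_eq {u : Fin B.nV} {a : Fin A.nA} (h : A.src a = d.v u) :
    ∃ b, d.s b = a ∧ B.src b = u := by
  obtain ⟨b, rfl⟩ := d.exists_s a fun h' => d.v_ne u (by rw [← h, h', d.src_β])
  exact ⟨b, rfl, d.v_inj ((d.src_s b).symm.trans h)⟩

theorem exists_tgt_eq {u : Fin B.nV} {a : Fin A.nA} (h : A.tgt a = d.v u) :
    ∃ b, d.t b = a ∧ B.tgt b = u := by
  obtain ⟨b, rfl⟩ := d.exists_t a fun h' => d.v_ne u (by rw [← h, h', d.tgt_α])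
  exact ⟨b, rfl, d.v_inj ((d.tgt_t b).symm.trans h)⟩

theorem card_src_le_one {u : Fin B.nV} (h : Nat.card {b // B.src b = u} ≤ 1) :
    Nat.card {a // A.src a = d.v u} ≤ 1 := by
  rw [card_fiber_le_one_iff] at h ⊢
  intro a b ha hb
  obtain ⟨a, rfl, ha'⟩ := d.exists_src_eq ha
  obtain ⟨b, rfl, hb'⟩ := d.exists_src_eq hb
  rw [h a b ha' hb']

theorem card_tgt_le_one {u : Fin B.nV} (h : Nat.card {b // B.tgt b = u} ≤ 1) :
    Nat.card {a // A.tgt a = d.v u} ≤ 1 := by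
  rw [card_fiber_le_one_iff] at h ⊢
  intro a b ha hb
  obtain ⟨a, rfl, ha'⟩ := d.exists_tgt_eq ha
  obtain ⟨b, rfl, hb'⟩ := d.exists_tgt_eq hb
  rw [h a b ha' hb']

theorem hasTrivPermThread {u : Fin B.nV} (h : B.HasTrivPermThread u) :
    A.HasTrivPermThread (d.v u) := by
  refine ⟨d.card_src_le_one h.1, d.card_tgt_le_one h.2.1, fun b c hb hc => ?_⟩
  obtain ⟨b, rfl, hb'⟩ := d.exists_tgt_eq hb
  obtain ⟨c, rfl, hc'⟩ := d.exists_src_eq hc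
  rw [← d.rel_iff]
  exact h.2.2 b c hb' hc'

theorem hasTrivForbThread {u : Fin B.nV} (h : B.HasTrivForbThread u) :
    A.HasTrivForbThread (d.v u) := by
  refine ⟨d.card_src_le_one h.1, d.card_tgt_le_one h.2.1, fun b c hb hc => ?_⟩
  obtain ⟨b, rfl, hb'⟩ := d.exists_tgt_eq hb
  obtain ⟨c, rfl, hc'⟩ := d.exists_src_eq hc
  rw [← d.rel_iff]
  exact h.2.2 b c hb' hc'

theorem hasTrivPermThread_of_map {u : Fin B.nV} (h : A.HasTrivPermThread (d.v u)) :
    B.HasTrivPermThread u := by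
  obtain ⟨h1, h2, h3⟩ := h
  rw [card_fiber_le_one_iff] at h1 h2
  refine ⟨(card_fiber_le_one_iff _ _).2 fun a b ha hb => ?_,
    (card_fiber_le_one_iff _ _).2 fun a b ha hb => ?_, fun b c hb hc => ?_⟩
  · exact d.s_inj (h1 _ _ (by rw [d.src_s, ha]) (by rw [d.src_s, hb]))
  · exact d.t_inj (h2 _ _ (by rw [d.tgt_t, ha]) (by rw [d.tgt_t, hb]))
  · rw [d.rel_iff]
    exact h3 _ _ (by rw [d.tgt_t, hb]) (by rw [d.src_s, hc])

theorem hasTrivPermThread_vertex (d : Contraction A B x α β) : A.HasTrivPermThread x := by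
  refine ⟨(card_fiber_le_one_iff _ _).2 fun a b ha hb => ?_,
    (card_fiber_le_one_iff _ _).2 fun a b ha hb => ?_, fun b c hb hc => ?_⟩
  · rw [d.eq_β a ha, d.eq_β b hb]
  · rw [d.eq_α a ha, d.eq_α b hb]
  · rw [d.eq_α b hb, d.eq_β c hc]
    exact d.not_rel

/-- The trivial permitted thread at the contracted vertex. -/
def point (d : Contraction A B x α β) : A.PermThread := .inr ⟨x, d.hasTrivPermThread_vertex⟩

theorem exists_expansion {l : List (Fin B.nA)} (hl : l.IsChain B.PermStep) :
    ∃ l' : List (Fin A.nA), l'.IsChain A.PermStep ∧ l'.head? = l.head?.map d.s ∧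
      l'.getLast? = l.getLast?.map d.t := by
  induction l with
  | nil => exact ⟨[], .nil, rfl, rfl⟩
  | cons b l ih =>
    rw [List.isChain_cons] at hl
    obtain ⟨l', hc, hh, hlast⟩ := ih hl.2
    have hl' : l' = [] ↔ l = [] := by
      rw [← List.head?_eq_none_iff, hh, Option.map_eq_none_iff, List.head?_eq_none_iff]
    have hc' : (d.t b :: l').IsChain A.PermStep := by
      refine List.isChain_cons.2 ⟨fun y hy => ?_, hc⟩
      rw [hh, Option.mem_map] at hy
      obtain ⟨c, hc, rfl⟩ := hy
      exact d.permStep_iff.1 (hl.1 c hc)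
    have hlast' : (d.t b :: l').getLast? = (b :: l).getLast?.map d.t := by
      rw [List.getLast?_cons, List.getLast?_cons, hlast]
      cases l.getLast? <;> rfl
    by_cases hb : b = d.γ
    · refine ⟨α :: d.t b :: l', ?_, ?_, ?_⟩
      · refine List.isChain_cons.2 ⟨fun y hy => ?_, hc'⟩
        obtain rfl : d.t b = y := by simpa using hy
        rw [hb, d.t_γ]
        exact d.permStep
      · simp [hb, d.s_γ]
      · rw [List.getLast?_cons_cons, hlast']
    · exact ⟨d.t b :: l', hc', by simp [d.s_eq_t b hb], hlast'⟩

theorem exists_compression (n : ℕ) (l : List (Fin A.nA)) (hn : l.length ≤ n)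
    (hl : l.IsChain A.PermStep)
    (b c : Fin B.nA) (hb : l.head? = some (d.s b)) (hc : l.getLast? = some (d.t c)) :
    ∃ l' : List (Fin B.nA), l'.IsChain B.PermStep ∧ l'.head? = some b ∧
      l'.getLast? = some c := by
  induction n generalizing l b with
  | zero =>
    rw [List.length_eq_zero_iff.1 (Nat.le_zero.1 hn)] at hb
    simp at hb
  | succ n ih =>
    have key : ∀ m : List (Fin A.nA), m.length ≤ n → (d.t b :: m).IsChain A.PermStep →
        (d.t b :: m).getLast? = some (d.t c) →
        ∃ l' : List (Fin B.nA), l'.IsChain B.PermStep ∧ l'.head? = some b ∧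
          l'.getLast? = some c := by
      intro m hm hch hla
      cases m with
      | nil =>
        have : b = c := d.t_inj (by simpa using hla)
        exact ⟨[b], .singleton _, rfl, by rw [← this]; rfl⟩
      | cons a m =>
        rw [List.isChain_cons_cons] at hch
        obtain ⟨b', rfl⟩ := d.exists_s_of_tgt_eq hch.1.1
        obtain ⟨l', h1, h2, h3⟩ := ih (d.s b' :: m) hm hch.2 b' rfl
          (by rwa [List.getLast?_cons_cons] at hla)
        refine ⟨b :: l', List.isChain_cons.2 ⟨fun y hy => ?_, h1⟩, rfl, ?_⟩
        · rw [h2, Option.mem_some_iff] at hy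
          exact hy ▸ d.permStep_iff.2 hch.1
        · rw [List.getLast?_cons, h3]; rfl
    cases l with
    | nil => simp at hb
    | cons a m =>
      obtain rfl : a = d.s b := by simpa using hb
      by_cases h : b = d.γ
      · cases m with
        | nil =>
          have : α = d.t c := by simpa [h, d.s_γ] using hc
          exact (d.t_ne c this.symm).elim
        | cons a m =>
          rw [List.isChain_cons_cons, h, d.s_γ] at hl
          have ha : a = d.t b := by
            rw [h, d.t_γ]
            exact d.eq_β a (hl.1.1.symm.trans d.tgt_α)
          subst ha
          refine key m (by simp at hn; omega) hl.2 ?_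
          rwa [List.getLast?_cons_cons] at hc
      · rw [d.s_eq_t b h] at hl hc
        exact key m (by simp at hn; omega) hl hc

theorem exists_lift (H : B.PermThread) : ∃ H' : A.PermThread,
    pFirst H' = (pFirst H).map d.s ∧ pLast H' = (pLast H).map d.t ∧
      A.pStart H' = d.v (B.pStart H) ∧ A.pEnd H' = d.v (B.pEnd H) := by
  rcases H with ⟨l, hl⟩ | ⟨u, hu⟩
  · have hm := isNontrivPermThread_iff.1 hl
    obtain ⟨l', hc, hh, hla⟩ := d.exists_expansion hm.chain
    have hne : l' ≠ [] := by
      rw [Ne, ← List.head?_eq_none_iff, hh, Option.map_eq_none_iff, List.head?_eq_none_iff]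
      exact hm.ne_nil
    have hl' : A.IsNontrivPermThread l' := by
      refine isNontrivPermThread_iff.2 ⟨hne, hc, fun a ha c h => ?_, fun a ha c h => ?_⟩
      · rw [hh, Option.mem_map] at ha
        obtain ⟨b, hb, rfl⟩ := ha
        obtain ⟨c, rfl⟩ := d.exists_t_of_tgt_eq h.1
        exact hm.not_left b hb c (d.permStep_iff.2 h)
      · rw [hla, Option.mem_map] at ha
        obtain ⟨b, hb, rfl⟩ := ha
        obtain ⟨c, rfl⟩ := d.exists_s_of_tgt_eq h.1
        exact hm.not_right b hb c (d.permStep_iff.2 h)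
    have hb := List.head?_eq_some_head hm.ne_nil
    have hz := List.getLast?_eq_some_getLast hm.ne_nil
    refine ⟨.inl ⟨l', hl'⟩, hh, hla, ?_, ?_⟩
    · rw [← src_of_pFirst (A := A) (a := d.s (l.head hm.ne_nil)), d.src_s]
      · rfl
      · exact hh.trans (by rw [hb]; rfl)
    · rw [← tgt_of_pLast (A := A) (a := d.t (l.getLast hm.ne_nil)), d.tgt_t]
      · rfl
      · exact hla.trans (by rw [hz]; rfl)
  · exact ⟨.inr ⟨d.v u, d.hasTrivPermThread hu⟩, rfl, rfl, rfl, rfl⟩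

/-- The permitted thread of `A` obtained by replacing `γ` with the path `α`, `β`. -/
noncomputable def lift (H : B.PermThread) : A.PermThread := (d.exists_lift H).choose

theorem pFirst_lift (H : B.PermThread) : pFirst (d.lift H) = (pFirst H).map d.s :=
  (d.exists_lift H).choose_spec.1

theorem pLast_lift (H : B.PermThread) : pLast (d.lift H) = (pLast H).map d.t :=
  (d.exists_lift H).choose_spec.2.1

theorem pStart_lift (H : B.PermThread) : A.pStart (d.lift H) = d.v (B.pStart H) :=
  (d.exists_lift H).choose_spec.2.2.1

theorem pEnd_lift (H : B.PermThread) : A.pEnd (d.lift H) = d.v (B.pEnd H) :=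
  (d.exists_lift H).choose_spec.2.2.2

theorem lift_injective : Function.Injective d.lift := by
  intro H H' h
  refine permThread_ext (Option.map_injective d.s_inj ?_) (d.v_inj ?_)
  · rw [← d.pFirst_lift, ← d.pFirst_lift, h]
  · rw [← d.pStart_lift, ← d.pStart_lift, h]

theorem lift_ne_point (H : B.PermThread) : d.lift H ≠ d.point := by
  intro h
  refine d.v_ne (B.pStart H) ?_
  rw [← d.pStart_lift, h]
  rfl

theorem exists_lift_eq {K : A.PermThread} (hK : K ≠ d.point) : ∃ H, d.lift H = K := by
  rcases K with ⟨l, hl⟩ | ⟨y, hy⟩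
  · have hm := isNontrivPermThread_iff.1 hl
    have hhd := List.head?_eq_some_head hm.ne_nil
    have hla := List.getLast?_eq_some_getLast hm.ne_nil
    obtain ⟨b, hb⟩ := d.exists_s (l.head hm.ne_nil) fun h =>
      hm.not_left _ hhd α (h ▸ d.permStep)
    obtain ⟨c, hc⟩ := d.exists_t (l.getLast hm.ne_nil) fun h =>
      hm.not_right _ hla β (h ▸ d.permStep)
    rw [← hb] at hhd
    rw [← hc] at hla
    obtain ⟨l', h1, h2, h3⟩ := d.exists_compression l.length l le_rfl hm.chain b c hhd hla
    have hl' : B.IsNontrivPermThread l' := by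
      refine isNontrivPermThread_iff.2 ⟨fun h => by simp [h] at h2, h1,
        fun a ha e h => ?_, fun a ha e h => ?_⟩
      · rw [Option.mem_unique ha h2] at h
        exact hm.not_left _ hhd _ (d.permStep_iff.1 h)
      · rw [Option.mem_unique ha h3] at h
        exact hm.not_right _ hla _ (d.permStep_iff.1 h)
    refine ⟨.inl ⟨l', hl'⟩, permThread_ext ?_ ?_⟩
    · rw [d.pFirst_lift]
      change l'.head?.map d.s = l.head?
      rw [h2, hhd]; rfl
    · have hb' : pFirst (A := B) (.inl ⟨l', hl'⟩) = some b := h2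
      rw [d.pStart_lift, ← src_of_pFirst hb', ← d.src_s]
      exact src_of_pFirst (H := .inl ⟨l, hl⟩) hhd
  · obtain ⟨u, rfl⟩ := d.exists_v y fun h => by
      subst h
      exact hK rfl
    refine ⟨.inr ⟨u, d.hasTrivPermThread_of_map hy⟩, permThread_ext ?_ ?_⟩
    · rw [d.pFirst_lift]; rfl
    · rw [d.pStart_lift]; rfl

theorem endRel_lift {H : B.PermThread} {F : B.ForbThread} (h : EndRel H F) {F' : A.ForbThread}
    (hl : fLast F' = (fLast F).map d.t) (hv : A.fEnd F' = d.v (B.fEnd F)) :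
    EndRel (d.lift H) F' := by
  refine ⟨by rw [hv, h.1, d.pEnd_lift], h.2.imp (fun h2 => ?_) fun h2 a ha => ?_⟩
  · rw [d.pLast_lift, hl]
    exact (Option.map_injective d.t_inj).ne h2
  · rw [d.pEnd_lift] at ha
    obtain ⟨b, -, hb⟩ := d.exists_tgt_eq ha
    exact h2 b hb

theorem startRel_lift {H : B.PermThread} {F : B.ForbThread} (h : StartRel F H)
    {F' : A.ForbThread} (hl : fFirst F' = (fFirst F).map d.s)
    (hv : A.fStart F' = d.v (B.fStart F)) : StartRel F' (d.lift H) := by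
  refine ⟨by rw [hv, ← h.1, d.pStart_lift], h.2.imp (fun h2 => ?_) fun h2 a ha => ?_⟩
  · rw [d.pFirst_lift, hl]
    exact (Option.map_injective d.s_inj).ne h2
  · rw [d.pStart_lift] at ha
    obtain ⟨b, -, hb⟩ := d.exists_src_eq ha
    exact h2 b hb

theorem chain_forbStep_iff {l : List (Fin B.nA)} {c : Fin B.nA} (h : d.γ ∉ l.dropLast) :
    (c :: l).IsChain B.ForbStep ↔ (d.t c :: l.map d.s).IsChain A.ForbStep := by
  induction l generalizing c with
  | nil => simp
  | cons b l ih =>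
    rw [List.map_cons, List.isChain_cons_cons, List.isChain_cons_cons, ← d.forbStep_iff]
    cases l with
    | nil => simp
    | cons b' l =>
      simp only [List.dropLast_cons_cons, List.mem_cons, not_or] at h
      rw [ih h.2, d.s_eq_t b (Ne.symm h.1)]

theorem map_s_eq_map_t {l : List (Fin B.nA)} (h : d.γ ∉ l) : l.map d.s = l.map d.t :=
  List.map_congr_left fun b hb => d.s_eq_t b fun e => h (e ▸ hb)

theorem not_forbStep_s {b : Fin B.nA} (h : ∀ c, ¬ B.ForbStep c b) (c : Fin A.nA) :
    ¬ A.ForbStep c (d.s b) := by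
  intro hc
  obtain ⟨c, rfl⟩ := d.exists_t_of_tgt_eq (A.rel_comp _ _ hc).symm
  exact h c (d.forbStep_iff.2 hc)

theorem not_forbStep_t {b : Fin B.nA} (h : ∀ c, ¬ B.ForbStep b c) (c : Fin A.nA) :
    ¬ A.ForbStep (d.t b) c := by
  intro hc
  obtain ⟨c, rfl⟩ := d.exists_s_of_tgt_eq (A.rel_comp _ _ hc).symm
  exact h c (d.forbStep_iff.2 hc)

theorem maxChain_map {l : List (Fin B.nA)} (h : MaxChain B.ForbStep l) (hγ : d.γ ∉ l) :
    MaxChain A.ForbStep (l.map d.s) := by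
  refine ⟨by simpa using h.ne_nil, ?_, fun a ha => ?_, fun a ha => ?_⟩
  · cases l with
    | nil => simp
    | cons b l =>
      rw [List.map_cons, d.s_eq_t b fun e => hγ (e ▸ List.mem_cons_self)]
      exact (d.chain_forbStep_iff fun h' => hγ
        (List.mem_cons_of_mem _ (List.mem_of_mem_dropLast h'))).1 h.chain
  · rw [List.head?_map, Option.mem_map] at ha
    obtain ⟨b, hb, rfl⟩ := ha
    exact d.not_forbStep_s (h.not_left b hb)
  · rw [d.map_s_eq_map_t hγ, List.getLast?_map, Option.mem_map] at ha
    obtain ⟨b, hb, rfl⟩ := ha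
    exact d.not_forbStep_t (h.not_right b hb)

theorem maxChain_map_left {l₁ l₂ : List (Fin B.nA)}
    (h : MaxChain B.ForbStep (l₁ ++ d.γ :: l₂)) (hγ : d.γ ∉ l₁) :
    MaxChain A.ForbStep ((l₁ ++ [d.γ]).map d.s) := by
  refine ⟨by simp, ?_, fun a ha => ?_, fun a ha => ?_⟩
  · have hc : (l₁ ++ [d.γ]).IsChain B.ForbStep := by
      have := h.chain
      rw [← List.singleton_append, ← List.append_assoc] at this
      exact this.left_of_append
    cases l₁ with
    | nil => simp
    | cons b l =>
      rw [List.mem_cons, not_or] at hγ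
      rw [List.cons_append, List.map_cons, d.s_eq_t b (Ne.symm hγ.1)]
      exact (d.chain_forbStep_iff (by simpa using hγ.2)).1 hc
  · rw [List.head?_map, Option.mem_map] at ha
    obtain ⟨b, hb, rfl⟩ := ha
    refine d.not_forbStep_s (h.not_left b ?_)
    cases l₁ <;> exact hb
  · have : α = a := by simpa [d.s_γ] using ha
    exact this ▸ d.not_forbStep_α

theorem maxChain_map_right {l₁ l₂ : List (Fin B.nA)}
    (h : MaxChain B.ForbStep (l₁ ++ d.γ :: l₂)) (hγ : d.γ ∉ l₂) :
    MaxChain A.ForbStep ((d.γ :: l₂).map d.t) := by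
  refine ⟨by simp, ?_, fun a ha => ?_, fun a ha => ?_⟩
  · rw [List.map_cons, ← d.map_s_eq_map_t hγ]
    exact (d.chain_forbStep_iff fun h' => hγ (List.mem_of_mem_dropLast h')).1
      h.chain.right_of_append
  · have : β = a := by simpa [d.t_γ] using ha
    exact this ▸ d.not_forbStep_β
  · rw [List.getLast?_map, Option.mem_map] at ha
    obtain ⟨b, hb, rfl⟩ := ha
    refine d.not_forbStep_t (h.not_right b ?_)
    rw [List.getLast?_append_of_ne_nil _ (by simp)]
    exact hb

theorem fStart_eq {F : B.ForbThread} {F' : A.ForbThread} {b : Fin B.nA}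
    (hF : fFirst F = some b) (hF' : fFirst F' = some (d.s b)) :
    A.fStart F' = d.v (B.fStart F) := by
  rw [← src_of_fFirst hF', ← src_of_fFirst hF, d.src_s]

theorem fEnd_eq {F : B.ForbThread} {F' : A.ForbThread} {b : Fin B.nA}
    (hF : fLast F = some b) (hF' : fLast F' = some (d.t b)) :
    A.fEnd F' = d.v (B.fEnd F) := by
  rw [← tgt_of_fLast hF', ← tgt_of_fLast hF, d.tgt_t]

variable {SA : A.Signs} (PA : A.AGPairing SA) {SB : B.Signs} (PB : B.AGPairing SB)

theorem next_lift_of_notMem {H : B.PermThread} (hγ : d.γ ∉ fArrows (PB.forb H)) :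
    PA.next (d.lift H) = d.lift (PB.next H) ∧
      A.forbLen (PA.forb (d.lift H)) = B.forbLen (PB.forb H) := by
  have e := PB.endRel H
  have s := PB.startRel H
  revert e s hγ
  generalize PB.next H = K
  generalize PB.forb H = F
  intro hγ e s
  have key : ∃ F' : A.ForbThread, fFirst F' = (fFirst F).map d.s ∧
      fLast F' = (fLast F).map d.t ∧ A.fStart F' = d.v (B.fStart F) ∧
      A.fEnd F' = d.v (B.fEnd F) ∧ A.forbLen F' = B.forbLen F := by
    rcases F with l | ⟨u, hu⟩
    · have hm := d.maxChain_map (maxChain_of_endRel_startRel e s) hγ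
      have hfi := List.head?_eq_some_head l.2.1
      have hla := List.getLast?_eq_some_getLast l.2.1
      have hfi' : (l.1.map d.s).head? = l.1.head?.map d.s := List.head?_map
      have hla' : (l.1.map d.s).getLast? = l.1.getLast?.map d.t := by
        rw [d.map_s_eq_map_t (l := l.1) hγ, List.getLast?_map]
      refine ⟨.inl ⟨l.1.map d.s, isNontrivForbThread_of_maxChain (l.2.2.1.1.map d.s_inj) hm⟩,
        hfi', hla', d.fStart_eq hfi ?_, d.fEnd_eq hla ?_, List.length_map _⟩
      · exact hfi'.trans (by rw [hfi]; rfl)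
      · exact hla'.trans (by rw [hla]; rfl)
    · exact ⟨.inr ⟨d.v u, d.hasTrivForbThread hu⟩, rfl, rfl, rfl, rfl, rfl⟩
  obtain ⟨F', h1, h2, h3, h4, h5⟩ := key
  obtain ⟨h6, h7⟩ := PA.eq_of_rel (d.endRel_lift e h2 h4) (d.startRel_lift s h1 h3)
  exact ⟨h7, by rw [h6, h5]⟩

theorem next_lift_of_mem {H : B.PermThread} (hγ : d.γ ∈ fArrows (PB.forb H)) :
    PA.next (d.lift H) = d.point ∧ PA.next d.point = d.lift (PB.next H) ∧
      A.forbLen (PA.forb (d.lift H)) + A.forbLen (PA.forb d.point) =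
        B.forbLen (PB.forb H) + 1 := by
  have e := PB.endRel H
  have s := PB.startRel H
  revert e s hγ
  generalize PB.next H = K
  generalize PB.forb H = F
  intro hγ e s
  rcases F with ⟨l, hl⟩ | ⟨u, hu⟩
  swap
  · simp [fArrows] at hγ
  have hm := maxChain_of_endRel_startRel e s
  obtain ⟨l₁, l₂, rfl⟩ := List.append_of_mem (show d.γ ∈ l from hγ)
  have hn := hl.2.1.1
  have hγ₁ : d.γ ∉ l₁ := fun h => List.disjoint_of_nodup_append hn h List.mem_cons_self
  have hγ₂ : d.γ ∉ l₂ := (List.nodup_cons.1 hn.of_append_right).1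
  have hn₁ : (l₁ ++ [d.γ]).Nodup := hn.sublist (by simp)
  let F₁ : A.ForbThread := .inl ⟨(l₁ ++ [d.γ]).map d.s,
    isNontrivForbThread_of_maxChain (hn₁.map d.s_inj) (d.maxChain_map_left hm hγ₁)⟩
  let F₂ : A.ForbThread := .inl ⟨(d.γ :: l₂).map d.t,
    isNontrivForbThread_of_maxChain (hn.of_append_right.map d.t_inj)
      (d.maxChain_map_right hm hγ₂)⟩
  have hfi := List.head?_eq_some_head hl.1
  have hla := List.getLast?_eq_some_getLast hl.1
  have hfi₁ : fFirst F₁ = (l₁ ++ d.γ :: l₂).head?.map d.s := by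
    change List.head? _ = _
    rw [List.head?_map]
    cases l₁ <;> rfl
  have hla₂ : fLast F₂ = (l₁ ++ d.γ :: l₂).getLast?.map d.t := by
    change ((d.γ :: l₂).map d.t).getLast? = _
    rw [List.getLast?_map, List.getLast?_append_of_ne_nil l₁ (List.cons_ne_nil d.γ l₂)]
  have hla₁ : fLast F₁ = some α := by
    change List.getLast? _ = _
    simp [d.s_γ]
  have hfi₂ : fFirst F₂ = some β := by
    change ((d.γ :: l₂).map d.t).head? = _
    simp [d.t_γ]
  have e₂ : EndRel (d.lift H) F₂ := d.endRel_lift e hla₂ (d.fEnd_eq hla (by rw [hla₂, hla]; rfl))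
  have s₂ : StartRel F₂ d.point :=
    ⟨by rw [← src_of_fFirst hfi₂, d.src_β]; rfl, Or.inl (by rw [hfi₂]; simp [point, pFirst])⟩
  have e₁ : EndRel d.point F₁ :=
    ⟨by rw [← tgt_of_fLast hla₁, d.tgt_α]; rfl, Or.inl (by rw [hla₁]; simp [point, pLast])⟩
  have s₁ : StartRel F₁ (d.lift K) :=
    d.startRel_lift s hfi₁ (d.fStart_eq hfi (by rw [hfi₁, hfi]; rfl))
  obtain ⟨h1, h2⟩ := PA.eq_of_rel e₂ s₂
  obtain ⟨h3, h4⟩ := PA.eq_of_rel e₁ s₁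
  refine ⟨h2, h4, ?_⟩
  rw [h1, h3]
  simp only [forbLen, F₁, F₂, List.length_map, List.length_append, List.length_cons,
    List.length_nil]
  omega

theorem exists_relCycle_of_next_point (h : PA.next d.point = d.point) :
    ∃ l, B.IsRelCycle (d.γ :: l) ∧ A.forbLen (PA.forb d.point) = (d.γ :: l).length + 1 := by
  have e := PA.endRel d.point
  have s := PA.startRel d.point
  rw [h] at s
  revert e s
  generalize PA.forb d.point = F
  intro e s
  rcases F with ⟨l, hl⟩ | ⟨u, hu⟩
  swap
  · obtain rfl : u = x := e.1
    exact (d.not_rel (hu.2.2 α β d.tgt_α d.src_β)).elim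
  have hc := hl.2.1.2
  have hn := hl.2.1.1
  have hfi : l.head? = some β := by
    have h1 := List.head?_eq_some_head hl.1
    rw [h1, d.eq_β _ ((src_of_fFirst (F := .inl ⟨l, hl⟩) h1).trans s.1.symm)]
  have hla : l.getLast? = some α := by
    have h1 := List.getLast?_eq_some_getLast hl.1
    rw [h1, d.eq_α _ ((tgt_of_fLast (F := .inl ⟨l, hl⟩) h1).trans e.1)]
  obtain ⟨m, rfl⟩ := List.head?_eq_some_iff.1 hfi
  have hmne : m ≠ [] := by
    rintro rfl
    exact d.ne (by simpa using hla.symm)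
  obtain ⟨g, rfl⟩ : ∃ g, m = g ++ [α] := by
    rw [List.getLast?_cons] at hla
    cases hm : m.getLast? with
    | none => exact (hmne (List.getLast?_eq_none_iff.1 hm)).elim
    | some z =>
      rw [hm] at hla
      obtain rfl : z = α := by simpa using hla
      exact List.getLast?_eq_some_iff.1 hm
  have hβ : β ∉ g := fun h => (List.nodup_cons.1 hn).1 (List.mem_append_left _ h)
  have hg : g ∈ Set.range (List.map d.s) := by
    rw [Set.range_list_map]
    exact fun a ha => d.exists_s a fun h => hβ (h ▸ ha)
  obtain ⟨g, rfl⟩ := hg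
  have hα : α ∉ g.map d.s := fun h =>
    List.disjoint_of_nodup_append (List.nodup_cons.1 hn).2 h List.mem_cons_self
  have hγ : d.γ ∉ g := fun h => hα (List.mem_map.2 ⟨_, h, d.s_γ⟩)
  refine ⟨g, isRelCycle_cons_iff.2 ⟨?_, ?_⟩, ?_⟩
  · exact List.nodup_cons.2 ⟨hγ, ((List.nodup_cons.1 hn).2.of_append_left).of_map⟩
  · rw [d.chain_forbStep_iff (by simpa using hγ), d.t_γ, List.map_append, List.map_singleton,
      d.s_γ]
    exact hc
  · simp [forbLen]

theorem relCycleCount_eq (d : Contraction A B x α β) (q : ℕ) : A.relCycleCount q =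
    {l : List (Fin B.nA) | (B.IsRelCycle l ∧ l.length = q) ∧ d.γ ∉ l}.ncard := by
  rw [← Set.ncard_image_of_injective _ (List.map_injective_iff.2 d.s_inj), relCycleCount]
  congr 1
  have key : ∀ l : List (Fin B.nA), d.γ ∉ l → (A.IsRelCycle (l.map d.s) ↔ B.IsRelCycle l) := by
    intro l hl
    cases l with
    | nil => exact ⟨fun h => (h.1 rfl).elim, fun h => (h.1 rfl).elim⟩
    | cons b l =>
      rw [List.mem_cons, not_or] at hl
      rw [List.map_cons, isRelCycle_cons_iff, isRelCycle_cons_iff, ← List.map_cons,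
        List.nodup_map_iff d.s_inj, d.chain_forbStep_iff (by simpa using hl.2), List.map_append,
        List.map_singleton, d.s_eq_t b (Ne.symm hl.1)]
  ext l
  constructor
  · rintro ⟨hl, hq⟩
    have hβ : β ∉ l := fun h => by
      obtain ⟨b, hb⟩ := hl.exists_forbStep_left h
      exact d.not_forbStep_β b hb
    have hα : α ∉ l := fun h => by
      obtain ⟨b, -, hb⟩ := hl.exists_forbStep_right h
      exact d.not_forbStep_α b hb
    have hr : l ∈ Set.range (List.map d.s) := by
      rw [Set.range_list_map]
      exact fun a ha => d.exists_s a fun h => hβ (h ▸ ha)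
    obtain ⟨l, rfl⟩ := hr
    have hγ : d.γ ∉ l := fun h => hα (List.mem_map.2 ⟨_, h, d.s_γ⟩)
    exact ⟨l, ⟨⟨(key l hγ).1 hl, by simpa using hq⟩, hγ⟩, rfl⟩
  · rintro ⟨l, ⟨⟨hl, hq⟩, hγ⟩, rfl⟩
    exact ⟨(key l hγ).2 hl, by simpa using hq⟩

end Contraction

namespace GentleAlg.AGPairing

open OrbitCount

variable {A : GentleAlg} {S : A.Signs} (P : A.AGPairing S)

/-- The number of permitted threads lying on an orbit of the algorithm with invariant `p`. -/
noncomputable def threadCount (p : ℕ × ℕ) : ℕ :=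
  Nat.card {H // orbitPair P.next (fun K => A.forbLen (P.forb K)) H = p}

theorem agPhi_zero (q : ℕ) : A.agPhi P 0 q = A.relCycleCount q / q := by
  rw [agPhi, if_pos rfl]
  rfl

theorem agPhi_of_ne_zero {p : ℕ} (hp : p ≠ 0) (q : ℕ) :
    A.agPhi P p q = P.threadCount (p, q) / p := by
  rw [agPhi, if_neg hp, threadCount]
  congr 1
  refine Nat.card_congr (Equiv.subtypeEquivRight fun H => ?_)
  rw [orbitPair, Prod.mk.injEq]
  constructor
  · rintro ⟨rfl, h⟩
    exact ⟨rfl, h⟩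
  · rintro ⟨rfl, h⟩
    exact ⟨rfl, h⟩

theorem finite_support_agPhi : (support fun p : ℕ × ℕ => A.agPhi P p.1 p.2).Finite := by
  refine (((Set.finite_singleton 0).prod (Set.finite_Iic A.nA)).union
    (Set.finite_range (orbitPair P.next fun K => A.forbLen (P.forb K)))).subset ?_
  rintro ⟨p, q⟩ h
  by_contra hpq
  rw [Set.mem_union, not_or] at hpq
  refine h ?_
  by_cases hp : p = 0
  · subst hp
    have hq : A.nA < q := by simpa using hpq.1
    have he : {l : List (Fin A.nA) | A.IsRelCycle l ∧ l.length = q} = ∅ := by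
      refine Set.eq_empty_of_forall_notMem fun l hl => ?_
      have := hl.1.2.1.length_le_card
      rw [Fintype.card_fin, hl.2] at this
      omega
    change A.agPhi P 0 q = 0
    rw [agPhi_zero, relCycleCount, he, Set.ncard_empty, Nat.zero_div]
  · change A.agPhi P p q = 0
    have : IsEmpty {H // orbitPair P.next (fun K => A.forbLen (P.forb K)) H = (p, q)} :=
      ⟨fun H => hpq.2 ⟨H.1, H.2⟩⟩
    rw [P.agPhi_of_ne_zero hp, threadCount, Nat.card_of_isEmpty, Nat.zero_div]

end GentleAlg.AGPairing

namespace Contraction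

open GentleAlg OrbitCount

variable {A B : GentleAlg} {x : Fin A.nV} {α β : Fin A.nA} (d : Contraction A B x α β)
  {SA : A.Signs} (PA : A.AGPairing SA) {SB : B.Signs} (PB : B.AGPairing SB)

theorem exists_shift_of_mem {H₀ : B.PermThread} (hγ : d.γ ∈ fArrows (PB.forb H₀)) :
    ∃ (n m : ℕ) (g : ℕ × ℕ → ℕ),
      (∀ p q, B.agPhi PB p q = g (p, q) + if (p, q) = (n, m) then 1 else 0) ∧
      ∀ p q, A.agPhi PA p q = g (p, q) + if (p, q) = (n + 1, m + 1) then 1 else 0 := by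
  have hun : ∀ H, H ≠ H₀ → d.γ ∉ fArrows (PB.forb H) := fun H hH h => hH <|
    d.lift_injective <| PA.next_bij.injective <|
      (d.next_lift_of_mem PA PB h).1.trans (d.next_lift_of_mem PA PB hγ).1.symm
  obtain ⟨h₁, h₂, h₃⟩ := d.next_lift_of_mem PA PB hγ
  obtain ⟨n, m, g, hn, hgB, hgA⟩ := card_orbitPair_of_insert PB.next_bij.injective
    (w := fun K => B.forbLen (PB.forb K)) PA.next_bij.injective
    (u := fun K => A.forbLen (PA.forb K)) d.lift_injective d.lift_ne_point
    (fun _ => d.exists_lift_eq) h₁ h₂ h₃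
    (fun H hH => (d.next_lift_of_notMem PA PB (hun H hH)).1)
    fun H hH => (d.next_lift_of_notMem PA PB (hun H hH)).2
  change (∀ p, PB.threadCount p = _) at hgB
  change (∀ p, PA.threadCount p = _) at hgA
  have hcyc : ∀ q, B.relCycleCount q = A.relCycleCount q := by
    intro q
    rw [relCycleCount_eq_add d.γ, d.relCycleCount_eq, Nat.add_eq_left,
      Set.ncard_eq_zero ((List.finite_length_eq _ q).subset fun m h => h.1.2)]
    refine Set.eq_empty_of_forall_notMem fun l hl => ?_
    have e := PB.endRel H₀
    have s := PB.startRel H₀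
    rcases hF : PB.forb H₀ with F | u
    · rw [hF] at e s hγ
      exact hl.1.1.notMem_maxChain (maxChain_of_endRel_startRel e s) hl.2 hγ
    · rw [hF] at hγ
      simp [fArrows] at hγ
  refine ⟨n, m, fun p => if p.1 = 0 then A.relCycleCount p.2 / p.2 else g p / p.1,
    fun p q => ?_, fun p q => ?_⟩
  · dsimp only
    by_cases hp : p = 0
    · subst hp
      rw [PB.agPhi_zero, hcyc, if_neg fun h => hn.ne (Prod.mk.inj h).1]
      simp
    · rw [PB.agPhi_of_ne_zero hp, hgB, if_neg hp]
      split_ifs with h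
      · obtain ⟨rfl, rfl⟩ := Prod.mk.inj h
        exact Nat.add_div_right _ hn
      · rfl
  · dsimp only
    by_cases hp : p = 0
    · subst hp
      rw [PA.agPhi_zero, if_neg fun h => (Nat.succ_ne_zero n) (Prod.mk.inj h).1.symm]
      simp
    · rw [PA.agPhi_of_ne_zero hp, hgA, if_neg hp]
      split_ifs with h
      · obtain ⟨rfl, rfl⟩ := Prod.mk.inj h
        exact Nat.add_div_right _ n.succ_pos
      · rfl

theorem exists_shift_of_forall_notMem (hγ : ∀ H, d.γ ∉ fArrows (PB.forb H)) :
    ∃ (n m : ℕ) (g : ℕ × ℕ → ℕ),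
      (∀ p q, B.agPhi PB p q = g (p, q) + if (p, q) = (n, m) then 1 else 0) ∧
      ∀ p q, A.agPhi PA p q = g (p, q) + if (p, q) = (n + 1, m + 1) then 1 else 0 := by
  have hfix : PA.next d.point = d.point := by
    obtain ⟨K, hK⟩ := PA.next_bij.surjective d.point
    by_cases h : K = d.point
    · rwa [h] at hK
    · obtain ⟨H, rfl⟩ := d.exists_lift_eq h
      rw [(d.next_lift_of_notMem PA PB (hγ H)).1] at hK
      exact (d.lift_ne_point _ hK).elim
  obtain ⟨l, hl, hlen⟩ := d.exists_relCycle_of_next_point PA hfix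
  have hA := card_orbitPair_of_fixed (σ := PB.next) (w := fun K => B.forbLen (PB.forb K))
    (u := fun K => A.forbLen (PA.forb K)) d.lift_injective d.lift_ne_point
    (fun _ => d.exists_lift_eq) hfix
    (fun H => (d.next_lift_of_notMem PA PB (hγ H)).1)
    fun H => (d.next_lift_of_notMem PA PB (hγ H)).2
  change (∀ p, PA.threadCount p = PB.threadCount p + _) at hA
  refine ⟨0, (d.γ :: l).length,
    fun p => if p.1 = 0 then A.relCycleCount p.2 / p.2 else PB.threadCount p / p.1,
    fun p q => ?_, fun p q => ?_⟩
  · dsimp only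
    by_cases hp : p = 0
    · subst hp
      rw [PB.agPhi_zero, relCycleCount_eq_add d.γ, ← d.relCycleCount_eq, hl.ncard_mem, if_pos rfl]
      simp only [Prod.mk.injEq, true_and]
      split_ifs with h
      · subst h
        exact Nat.add_div_right _ (by simp)
      · rfl
    · rw [PB.agPhi_of_ne_zero hp, if_neg hp, if_neg fun h => hp (Prod.mk.inj h).1, add_zero]
  · dsimp only
    by_cases hp : p = 0
    · subst hp
      rw [PA.agPhi_zero, if_pos rfl, zero_add,
        if_neg fun h => zero_ne_one (Prod.mk.inj h).1, add_zero]
    · rw [PA.agPhi_of_ne_zero hp, hA, if_neg hp, hlen, zero_add]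
      split_ifs with h
      · obtain ⟨rfl, rfl⟩ := Prod.mk.inj h
        simp
      · rfl

end Contraction

/-- `φ_A` is obtained from `φ_{A∖{x}}` by replacing exactly one pair
`(n,m)` of the support by `(n+1, m+1)`; in particular the total multiplicities agree. -/
theorem phi_contraction (A : GentleAlg) (hconn : A.toFinQuiver.Connected)
    (hc : A.toFinQuiver.numCycles = 2) (h6 : 6 ≤ A.nV)
    (x : Fin A.nV) (α β : Fin A.nA) (ht : GentleAlg.TransitionAt A x α β)
    (B : GentleAlg) (hB : GentleAlg.IsContraction A x α β B)
    (SA : A.Signs) (PA : GentleAlg.AGPairing A SA)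
    (SB : B.Signs) (PB : GentleAlg.AGPairing B SB) :
    ∃ (M : Multiset (ℕ × ℕ)) (n m : ℕ),
      (∀ p q, GentleAlg.agPhi PB p q = Multiset.count (p, q) ((n, m) ::ₘ M)) ∧
      (∀ p q, GentleAlg.agPhi PA p q = Multiset.count (p, q) ((n + 1, m + 1) ::ₘ M)) := by
  obtain ⟨d⟩ := hB.nonempty_contraction ht
  have key : ∃ (n m : ℕ) (g : ℕ × ℕ → ℕ),
      (∀ p q, B.agPhi PB p q = g (p, q) + if (p, q) = (n, m) then 1 else 0) ∧
      ∀ p q, A.agPhi PA p q = g (p, q) + if (p, q) = (n + 1, m + 1) then 1 else 0 := by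
    by_cases h : ∃ H, d.γ ∈ GentleAlg.fArrows (PB.forb H)
    · exact d.exists_shift_of_mem PA PB h.choose_spec
    · exact d.exists_shift_of_forall_notMem PA PB (not_exists.1 h)
  obtain ⟨n, m, g, hgB, hgA⟩ := key
  obtain ⟨M, hM, hM'⟩ := OrbitCount.exists_multiset_of_shift PB.finite_support_agPhi
    (fun p => hgB p.1 p.2) (f' := fun p => A.agPhi PA p.1 p.2) fun p => hgA p.1 p.2
  exact ⟨M, n, m, fun p q => hM (p, q), fun p q => hM' (p, q)⟩
end
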